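/- arXiv:math/0401134 — 7 statements merged into one kernel-verified Lean document; each statement's English description precedes it below -/
import Mathlib

section
/- Let φ and ψ be diffuse Maharam submeasures on the Borel subsets of Cantor space 2^ℕ and assume φ does not have a control measure, i.e. there is no finite Borel measure μ such that for every Borel set C, μ(C) = 0 if and only if φ(C) = 0. Then there is a Borel set A ⊆ 2^ℕ × 2^ℕ such that ψ(A_x) = 0 for every x ∈ 2^ℕ and inf over y ∈ 2^ℕ of φ(A^y) is strictly positive, where A_x = {y : (x,y) ∈ A} and A^y = {x : (x,y) ∈ A}. -/
open Set Filter NNReal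

/-- Cantor space `2^ℕ`. -/
abbrev Cantor := ℕ → Bool

/-- A submeasure on the Borel subsets of Cantor space: vanishes on `∅`, is
monotone and subadditive on Borel sets. -/
def Submeasure (φ : Set Cantor → ℝ≥0) : Prop :=
  φ ∅ = 0 ∧
  (∀ A B : Set Cantor, MeasurableSet A → MeasurableSet B → A ⊆ B → φ A ≤ φ B) ∧
  (∀ A B : Set Cantor, MeasurableSet A → MeasurableSet B → φ (A ∪ B) ≤ φ A + φ B)

/-- A Maharam (continuous) submeasure: a submeasure which is continuous along
decreasing sequences of Borel sets. -/
def Maharam (φ : Set Cantor → ℝ≥0) : Prop :=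
  Submeasure φ ∧
  ∀ A : ℕ → Set Cantor, (∀ n, MeasurableSet (A n)) → Antitone A →
    Tendsto (fun n => φ (A n)) atTop (nhds (φ (⋂ n, A n)))

/-- `φ` is diffuse: singletons are null. -/
def Diffuse (φ : Set Cantor → ℝ≥0) : Prop :=
  ∀ x : Cantor, φ ({x} : Set Cantor) = 0

/-- `ν` is a finitely additive functional on the Borel sets. -/
def FinAdd (ν : Set Cantor → ℝ≥0) : Prop :=
  ν ∅ = 0 ∧
  ∀ A B : Set Cantor, MeasurableSet A → MeasurableSet B → Disjoint A B →
    ν (A ∪ B) = ν A + ν B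

/-- The counting estimate behind the existence of concentrators. -/
lemma sum_choose_mul_choose_lt {m l k : ℕ} (hl : 0 < l) (h : 27 * m * k ≤ l ^ 2) :
    ∑ i ∈ Finset.Icc 1 k, m.choose i * l.choose i * ((i ^ 3) ^ i * (l ^ 3) ^ (m - i))
      < (l ^ 3) ^ m := by
  have hl0 : (0 : ℝ) < l := by exact_mod_cast hl
  have term : ∀ i ∈ Finset.Icc 1 k,
      (m.choose i * l.choose i * ((i ^ 3) ^ i * (l ^ 3) ^ (m - i)) : ℝ)
        ≤ (1 / 3) ^ i * (l ^ 3) ^ m := by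
    intro i hi
    rw [Finset.mem_Icc] at hi
    rcases lt_or_ge m i with him | him
    · rw [Nat.choose_eq_zero_of_lt him]
      simp only [Nat.cast_zero, zero_mul]
      positivity
    have hfac : (i : ℝ) ^ i / i.factorial ≤ 3 ^ i := by
      refine (Real.pow_div_factorial_le_exp i (Nat.cast_nonneg i) i).trans ?_
      rw [← Real.exp_one_pow]
      exact pow_le_pow_left₀ (Real.exp_pos 1).le Real.exp_one_lt_three.le i
    have hbase : (m * l * (3 * 3) * i : ℝ) ≤ 1 / 3 * l ^ 3 := by
      have h1 : (27 * m * k : ℝ) ≤ l ^ 2 := by exact_mod_cast h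
      have h2 : (27 * m * i : ℝ) ≤ 27 * m * k := by
        have : (i : ℝ) ≤ k := by exact_mod_cast hi.2
        gcongr
      nlinarith [mul_le_mul_of_nonneg_right (h2.trans h1) hl0.le]
    calc (m.choose i * l.choose i * ((i ^ 3) ^ i * (l ^ 3) ^ (m - i)) : ℝ)
        ≤ (m ^ i / i.factorial) * (l ^ i / i.factorial)
            * ((i ^ 3) ^ i * (l ^ 3) ^ (m - i)) := by
          gcongr
          · exact Nat.choose_le_pow_div i m
          · exact Nat.choose_le_pow_div i l
      _ = (m * l * i) ^ i * (i ^ i / i.factorial) * (i ^ i / i.factorial)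
            * (l ^ 3) ^ (m - i) := by ring
      _ ≤ (m * l * i) ^ i * 3 ^ i * 3 ^ i * (l ^ 3) ^ (m - i) := by gcongr
      _ = (m * l * (3 * 3) * i) ^ i * (l ^ 3) ^ (m - i) := by
          simp only [mul_pow]; ring
      _ ≤ (1 / 3 * l ^ 3) ^ i * (l ^ 3) ^ (m - i) := by gcongr
      _ = (1 / 3) ^ i * ((l ^ 3) ^ i * (l ^ 3) ^ (m - i)) := by rw [mul_pow]; ring
      _ = (1 / 3) ^ i * (l ^ 3) ^ m := by rw [pow_mul_pow_sub _ him]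
  have geom : ∑ i ∈ Finset.Icc 1 k, (1 / 3 : ℝ) ^ i < 1 := by
    have : ∀ n : ℕ, ∑ i ∈ Finset.Icc 1 n, (1 / 3 : ℝ) ^ i ≤ 1 / 2 - 1 / 2 * (1 / 3) ^ n := by
      intro n
      induction n with
      | zero => simp
      | succ n ih =>
        rw [Finset.sum_Icc_succ_top (by omega), pow_succ]
        linarith
    have h3 := this k
    have : (0 : ℝ) < (1 / 3) ^ k := by positivity
    linarith
  have : ((∑ i ∈ Finset.Icc 1 k, m.choose i * l.choose i * ((i ^ 3) ^ i * (l ^ 3) ^ (m - i)) : ℕ)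
      : ℝ) < ((l ^ 3) ^ m : ℕ) := by
    push_cast
    calc _ ≤ ∑ i ∈ Finset.Icc 1 k, (1 / 3 : ℝ) ^ i * (l ^ 3) ^ m := Finset.sum_le_sum term
      _ = (∑ i ∈ Finset.Icc 1 k, (1 / 3 : ℝ) ^ i) * (l ^ 3) ^ m := by rw [Finset.sum_mul]
      _ < 1 * (l ^ 3) ^ m := by gcongr
      _ = _ := one_mul _
  exact_mod_cast this

/-- Existence of concentrators: a bipartite graph of left degree at most three in which every
set of at most `k` left vertices satisfies the Hall condition. -/
lemma exists_concentrator {m l k : ℕ} (hl : 0 < l) (hkl : k ≤ l) (h : 27 * m * k ≤ l ^ 2) :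
    ∃ e : Fin m → Fin 3 → Fin l, ∀ E : Finset (Fin m), E.card ≤ k →
      E.card ≤ (E.biUnion fun a => Finset.univ.image (e a)).card := by
  by_contra! hcon
  let bad : Finset (Fin m) → Finset (Fin l) → Finset (Fin m → Fin 3 → Fin l) := fun E L =>
    Fintype.piFinset fun a => if a ∈ E then Fintype.piFinset fun _ => L else Finset.univ
  have hbad : ∀ i, ∀ E ∈ Finset.powersetCard i (Finset.univ : Finset (Fin m)),
      ∀ L ∈ Finset.powersetCard i (Finset.univ : Finset (Fin l)),
      (bad E L).card = (i ^ 3) ^ i * (l ^ 3) ^ (m - i) := by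
    intro i E hE L hL
    rw [Finset.mem_powersetCard_univ] at hE hL
    simp only [bad, Fintype.card_piFinset, apply_ite Finset.card, Finset.prod_const, hL,
      Finset.card_univ, Fintype.card_fin, Fintype.card_pi]
    rw [Finset.prod_ite, Finset.prod_const, Finset.prod_const, Finset.filter_mem_eq_inter,
      Finset.univ_inter, hE, Finset.filter_not, Finset.filter_mem_eq_inter, Finset.univ_inter,
      Finset.card_sdiff_of_subset (Finset.subset_univ E), hE, Finset.card_univ, Fintype.card_fin]
  have hcover : (Finset.univ : Finset (Fin m → Fin 3 → Fin l)) ⊆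
      (Finset.Icc 1 k).biUnion fun i =>
        (Finset.powersetCard i Finset.univ).biUnion fun E =>
          (Finset.powersetCard i Finset.univ).biUnion fun L => bad E L := by
    intro e _
    obtain ⟨E, hEk, hE⟩ := hcon e
    obtain ⟨L, hL, hLE⟩ := Finset.exists_superset_card_eq hE.le
      (by rw [Fintype.card_fin]; omega)
    simp only [Finset.mem_biUnion, Finset.mem_Icc, Finset.mem_powersetCard_univ]
    refine ⟨E.card, ⟨by omega, hEk⟩, E, rfl, L, hLE, ?_⟩
    simp only [bad, Fintype.mem_piFinset]
    intro a
    split_ifs with ha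
    · rw [Fintype.mem_piFinset]
      exact fun t => hL (Finset.mem_biUnion.2 ⟨a, ha, Finset.mem_image_of_mem _ (Finset.mem_univ t)⟩)
    · exact Finset.mem_univ _
  have hcard := Finset.card_le_card hcover
  have hle : ((Finset.Icc 1 k).biUnion fun i =>
        (Finset.powersetCard i Finset.univ).biUnion fun E =>
          (Finset.powersetCard i Finset.univ).biUnion fun L => bad E L).card ≤
      ∑ i ∈ Finset.Icc 1 k, m.choose i * l.choose i * ((i ^ 3) ^ i * (l ^ 3) ^ (m - i)) := by
    refine Finset.card_biUnion_le.trans (Finset.sum_le_sum fun i _ => ?_)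
    refine Finset.card_biUnion_le.trans ?_
    calc _ ≤ ∑ E ∈ Finset.powersetCard i (Finset.univ : Finset (Fin m)),
          l.choose i * ((i ^ 3) ^ i * (l ^ 3) ^ (m - i)) := by
          refine Finset.sum_le_sum fun E hE => Finset.card_biUnion_le.trans ?_
          rw [Finset.sum_congr rfl (hbad i E hE)]
          simp
      _ = _ := by simp [mul_assoc]
  have := sum_choose_mul_choose_lt hl h
  have huniv : (Finset.univ : Finset (Fin m → Fin 3 → Fin l)).card = (l ^ 3) ^ m := by
    simp
  omega

namespace Submeasure

variable {φ : Set Cantor → ℝ≥0}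

lemma mono (h : Submeasure φ) {A B : Set Cantor} (hA : MeasurableSet A) (hB : MeasurableSet B)
    (hAB : A ⊆ B) : φ A ≤ φ B := h.2.1 A B hA hB hAB

lemma union_le (h : Submeasure φ) {A B : Set Cantor} (hA : MeasurableSet A)
    (hB : MeasurableSet B) : φ (A ∪ B) ≤ φ A + φ B := h.2.2 A B hA hB

lemma biUnion_le (h : Submeasure φ) {ι : Type*} (s : Finset ι) {A : ι → Set Cantor}
    (hA : ∀ i, MeasurableSet (A i)) : φ (⋃ i ∈ s, A i) ≤ ∑ i ∈ s, φ (A i) := by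
  classical
  induction s using Finset.induction_on with
  | empty => simp [h.1]
  | insert a s ha ih =>
    rw [Finset.set_biUnion_insert, Finset.sum_insert ha]
    exact (h.union_le (hA a) (s.measurableSet_biUnion fun i _ => hA i)).trans
      (add_le_add_right ih _)

/-- If no `q` pairwise disjoint sets have submeasure at least `ε / 3`, then among `27 q² k` sets
of submeasure at least `ε` there are more than `k` with a common point. -/
lemma exists_lt_card_filter_mem (h : Submeasure φ) {ε : ℝ≥0} {q k m : ℕ} (hq : 0 < q) (hk : 0 < k)
    (hm : m = 27 * q ^ 2 * k)
    (hdisj : ¬ ∃ D : Fin q → Set Cantor, (∀ i, MeasurableSet (D i)) ∧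
      Pairwise (fun i j => Disjoint (D i) (D j)) ∧ ∀ i, ε / 3 ≤ φ (D i))
    (C : Fin m → Set Cantor) (hC : ∀ i, MeasurableSet (C i))
    (hε : ∀ i, ε ≤ φ (C i)) :
    ∃ E : Finset (Fin m), k < E.card ∧ ∃ x, ∀ i ∈ E, x ∈ C i := by
  classical
  by_contra! hcon
  have hl : 0 < 27 * q * k := by positivity
  obtain ⟨e, he⟩ := exists_concentrator (m := m) (l := 27 * q * k) (k := k) hl
    (Nat.le_mul_of_pos_left k (by positivity)) (by rw [hm]; apply le_of_eq; ring)
  have hmatch : ∀ E : Finset (Fin m), ∃ t : Fin m → Fin 3, E.card ≤ k →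
      Set.InjOn (fun i => e i (t i)) E := by
    intro E
    by_cases hE : E.card ≤ k
    · obtain ⟨f, hf, hfe⟩ := (Finset.all_card_le_biUnion_card_iff_exists_injective
        (fun a : E => Finset.univ.image (e a))).1 (by
          intro s
          have := he (s.map (Function.Embedding.subtype _)) (by
            refine (Finset.card_le_card ?_).trans hE
            intro a ha
            obtain ⟨b, _, rfl⟩ := Finset.mem_map.1 ha
            exact b.2)
          rw [Finset.card_map] at this
          refine this.trans (Finset.card_le_card fun j hj => ?_)
          simpa using hj)
      have : ∀ a : E, ∃ t, e a t = f a := fun a => by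
        simpa using hfe a
      choose t ht using this
      refine ⟨fun i => if hi : i ∈ E then t ⟨i, hi⟩ else 0, fun _ i hi j hj hij => ?_⟩
      simp only [Finset.mem_coe] at hi hj
      simp only [hi, hj, dif_pos] at hij
      rw [ht ⟨i, hi⟩, ht ⟨j, hj⟩] at hij
      exact congrArg Subtype.val (hf hij)
    · exact ⟨fun _ => 0, fun h => absurd h hE⟩
  choose t ht using hmatch
  let S : Cantor → Finset (Fin m) := fun x => Finset.univ.filter fun i => x ∈ C i
  have hS : ∀ x, (S x).card ≤ k := by
    intro x
    by_contra! hx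
    obtain ⟨i, hi, hxi⟩ := hcon (S x) hx x
    exact hxi (Finset.mem_filter.1 hi).2
  have hSm : ∀ P : Finset (Fin m) → Prop, MeasurableSet {x | P (S x)} := by
    intro P
    have : {x | P (S x)} = ⋃ E ∈ (Finset.univ.filter P : Finset (Finset (Fin m))),
        ⋂ i, {x | x ∈ C i ↔ i ∈ E} := by
      ext x
      simp only [Set.mem_ofPred_eq, Set.mem_iUnion, Set.mem_iInter, Finset.mem_filter,
        Finset.mem_univ, true_and, exists_prop]
      constructor
      · exact fun hx => ⟨S x, hx, fun i => by simp [S]⟩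
      · rintro ⟨E, hE, hx⟩
        have : S x = E := by ext i; simp [S, hx]
        rwa [this]
    rw [this]
    refine Finset.measurableSet_biUnion _ fun E _ => MeasurableSet.iInter fun i => ?_
    by_cases hi : i ∈ E
    · simpa [hi] using hC i
    · simp only [hi, iff_false]
      exact (hC i).compl
  let b : Fin m → Fin 3 → Set Cantor := fun i s => {x | i ∈ S x ∧ t (S x) i = s}
  have hb : ∀ i s, MeasurableSet (b i s) := fun i s => hSm fun E => i ∈ E ∧ t E i = s
  have hbig : ∀ i, ∃ s, ε / 3 ≤ φ (b i s) := by
    intro i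
    by_contra! hlt
    have h1 : C i ⊆ ⋃ s ∈ (Finset.univ : Finset (Fin 3)), b i s := by
      intro x hx
      simp only [Finset.mem_univ, Set.iUnion_true, Set.mem_iUnion]
      exact ⟨t (S x) i, by simpa [S] using hx, rfl⟩
    have h2 := (hε i).trans ((h.mono (hC i)
      (Finset.measurableSet_biUnion _ fun s _ => hb i s) h1).trans
      (h.biUnion_le Finset.univ (hb i)))
    have h3 : ∑ s, φ (b i s) < ∑ _s : Fin 3, ε / 3 :=
      Finset.sum_lt_sum_of_nonempty Finset.univ_nonempty fun s _ => hlt s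
    have h4 : ∑ _s : Fin 3, ε / 3 = ε := by
      simp only [Finset.sum_const, Finset.card_univ, Fintype.card_fin, nsmul_eq_mul]
      push_cast
      field_simp
    exact absurd (h2.trans_lt h3) (by rw [h4]; exact lt_irrefl _)
  choose s hs using hbig
  have : Nonempty (Fin (27 * q * k)) := ⟨⟨0, hl⟩⟩
  obtain ⟨j, hj⟩ := Fintype.exists_le_card_fiber_of_mul_le_card (fun i : Fin m => e i (s i))
    (n := q) (by rw [Fintype.card_fin, Fintype.card_fin, hm]; apply le_of_eq; ring)
  obtain ⟨F, hF, hFq⟩ := Finset.exists_subset_card_eq hj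
  let g := F.equivFinOfCardEq hFq
  refine hdisj ⟨fun a => b (g.symm a) (s (g.symm a)), fun a => hb _ _, ?_, fun a => hs _⟩
  intro a a' haa'
  rw [Set.disjoint_left]
  rintro x ⟨hx1, hx2⟩ ⟨hy1, hy2⟩
  apply haa'
  apply g.symm.injective
  apply Subtype.ext
  apply ht (S x) (hS x) hx1 hy1
  have e1 := (Finset.mem_filter.1 (hF (g.symm a).2)).2
  have e2 := (Finset.mem_filter.1 (hF (g.symm a').2)).2
  simp only [hx2, hy2]
  exact e1.trans e2.symm

end Submeasure

section Kelley

open MeasureTheory CompactlySupportedContinuousMap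

/-- If no convex combination of functions in `K` is everywhere below `δ`, then some finite
measure integrates all functions of `K` to at least a fixed positive amount. -/
lemma exists_measure_forall_le_integral {X : Type*} [TopologicalSpace X] [CompactSpace X]
    [T2Space X] [MeasurableSpace X] [BorelSpace X] {K : Set C(X, ℝ)} {δ : ℝ} (hδ : 0 < δ)
    (hK : ∀ f ∈ convexHull ℝ K, ∃ x, δ ≤ f x) :
    ∃ μ : Measure X, IsFiniteMeasure μ ∧ ∃ s : ℝ, 0 < s ∧ ∀ f ∈ K, s ≤ ∫ x, f x ∂μ := by
  let U : Set C(X, ℝ) := {f | ∀ x, f x < δ}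
  have hUo : IsOpen U := by
    have := ContinuousMap.isOpen_setOfPred_mapsTo (Y := ℝ) (isCompact_univ (X := X))
      (isOpen_Iio (a := δ))
    convert this using 1
    ext f
    simp [U, Set.MapsTo]
  have hUc : Convex ℝ U := by
    intro f hf g hg a b ha hb hab x
    have h1 := hf x
    have h2 := hg x
    simp only [ContinuousMap.add_apply, ContinuousMap.smul_apply, smul_eq_mul]
    rcases ha.eq_or_lt with rfl | ha'
    · have : b = 1 := by linarith
      subst this
      linarith
    · nlinarith
  have hdis : Disjoint U (convexHull ℝ K) := by
    rw [Set.disjoint_left]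
    intro f hf hfK
    obtain ⟨x, hx⟩ := hK f hfK
    exact absurd (hf x) (not_lt.2 hx)
  obtain ⟨Λ, s, hΛU, hΛK⟩ := geometric_hahn_banach_open hUc hUo (convex_convexHull ℝ K) hdis
  have hs : 0 < s := by
    have := hΛU 0 (fun x => by simpa using hδ)
    simpa using this
  have hpos : ∀ g : C(X, ℝ), (∀ x, 0 ≤ g x) → 0 ≤ Λ g := by
    intro g hg
    by_contra! hneg
    have := hΛU ((s / Λ g) • g) (fun x => by
      have h1 : s / Λ g ≤ 0 := div_nonpos_of_nonneg_of_nonpos hs.le hneg.le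
      have h2 := mul_nonpos_of_nonpos_of_nonneg h1 (hg x)
      simp only [ContinuousMap.smul_apply, smul_eq_mul]
      linarith)
    rw [map_smul, smul_eq_mul, div_mul_cancel₀ _ hneg.ne] at this
    exact lt_irrefl _ this
  let Λ' : CompactlySupportedContinuousMap X ℝ →ₗ[ℝ] ℝ :=
    { toFun := fun f => Λ f.toContinuousMap
      map_add' := fun f g => by rw [← map_add]; rfl
      map_smul' := fun c f => by rw [RingHom.id_apply, ← map_smul]; rfl }
  let P : CompactlySupportedContinuousMap X ℝ →ₚ[ℝ] ℝ :=
    PositiveLinearMap.mk₀ Λ' fun f hf => hpos _ fun x => hf x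
  have hfin : IsFiniteMeasure (RealRMK.rieszMeasure P) := by
    have : IsFiniteMeasureOnCompacts (RealRMK.rieszMeasure P) := by
      unfold RealRMK.rieszMeasure
      infer_instance
    infer_instance
  refine ⟨RealRMK.rieszMeasure P, hfin, s, hs, fun f hf => ?_⟩
  have := RealRMK.integral_rieszMeasure P (continuousMapEquiv f)
  calc s ≤ Λ f := hΛK f (subset_convexHull ℝ K hf)
    _ = P (continuousMapEquiv f) := rfl
    _ = _ := this.symm

/-- A uniformly exhaustive submeasure at level `ε / 3` is controlled at level `ε` by a finite
measure on the clopen sets. -/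
lemma Submeasure.exists_measure_forall_isClopen {φ : Set Cantor → ℝ≥0} (h : Submeasure φ)
    {ε : ℝ≥0} {q : ℕ} (hq : 0 < q)
    (hdisj : ¬ ∃ D : Fin q → Set Cantor, (∀ i, MeasurableSet (D i)) ∧
      Pairwise (fun i j => Disjoint (D i) (D j)) ∧ ∀ i, ε / 3 ≤ φ (D i)) :
    ∃ μ : Measure Cantor, IsFiniteMeasure μ ∧ ∃ s : ENNReal, 0 < s ∧
      ∀ C, IsClopen C → ε ≤ φ C → s ≤ μ C := by
  classical
  let K : Set C(Cantor, ℝ) := {f | ∃ C, IsClopen C ∧ ε ≤ φ C ∧ ∀ x, f x = C.indicator 1 x}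
  have hK : ∀ f ∈ convexHull ℝ K, ∃ x, 1 / (2 * (27 * q ^ 2)) ≤ f x := by
    intro f hf
    by_contra! hlt
    rw [mem_convexHull_iff_exists_fintype] at hf
    obtain ⟨ι, _, w, z, hw0, hw1, hz, rfl⟩ := hf
    choose C hCc hCε hCz using hz
    set k := 2 * Fintype.card ι + 1 with hk
    let N : ι → ℕ := fun i => ⌈27 * q ^ 2 * k * w i⌉₊
    let T := Σ i, Fin (N i)
    have hT : 27 * q ^ 2 * k ≤ Fintype.card T := by
      have : (27 * q ^ 2 * k : ℝ) ≤ ∑ i, (N i : ℝ) :=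
        calc (27 * q ^ 2 * k : ℝ) = ∑ i, 27 * q ^ 2 * k * w i := by
              rw [← Finset.mul_sum, hw1, mul_one]
          _ ≤ _ := Finset.sum_le_sum fun i _ => Nat.le_ceil _
      rw [Fintype.card_sigma]
      simp only [Fintype.card_fin]
      exact_mod_cast this
    let g : Fin (27 * q ^ 2 * k) → T := fun i => (Fintype.equivFin T).symm (Fin.castLE hT i)
    have hg : Function.Injective g :=
      (Fintype.equivFin T).symm.injective.comp (Fin.castLE_injective hT)
    obtain ⟨E, hE, x, hx⟩ := h.exists_lt_card_filter_mem hq (k := k) (by omega) rfl hdisj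
      (fun i => C (g i).1) (fun i => (hCc _).isOpen.measurableSet) (fun i => hCε _)
    have hE' : E.card ≤ ∑ i ∈ Finset.univ.filter (fun i => x ∈ C i), N i := by
      calc E.card = (E.image g).card := (Finset.card_image_of_injective _ hg).symm
        _ ≤ ((Finset.univ.filter (fun i => x ∈ C i)).sigma
              fun i => (Finset.univ : Finset (Fin (N i)))).card := by
            refine Finset.card_le_card fun a ha => ?_
            obtain ⟨i, hi, rfl⟩ := Finset.mem_image.1 ha
            exact Finset.mem_sigma.2
              ⟨Finset.mem_filter.2 ⟨Finset.mem_univ _, hx i hi⟩, Finset.mem_univ _⟩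
        _ = _ := by simp [Finset.card_sigma]
    have hval : ∑ i ∈ Finset.univ.filter (fun i => x ∈ C i), w i < 1 / (2 * (27 * q ^ 2)) := by
      have := hlt x
      simp only [ContinuousMap.sum_apply, ContinuousMap.smul_apply, smul_eq_mul, hCz] at this
      rw [Finset.sum_filter]
      refine lt_of_eq_of_lt (Finset.sum_congr rfl fun i _ => ?_) this
      by_cases hi : x ∈ C i <;> simp [hi]
    have hkpos : (0 : ℝ) < k := by rw [hk]; positivity
    have h1 : (E.card : ℝ) ≤ k / 2 + Fintype.card ι := by
      calc (E.card : ℝ) ≤ ∑ i ∈ Finset.univ.filter (fun i => x ∈ C i), (N i : ℝ) := by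
            exact_mod_cast hE'
        _ ≤ ∑ i ∈ Finset.univ.filter (fun i => x ∈ C i), (27 * q ^ 2 * k * w i + 1) :=
            Finset.sum_le_sum fun i _ =>
              (Nat.ceil_lt_add_one (mul_nonneg (by positivity) (hw0 i))).le
        _ = 27 * q ^ 2 * k * ∑ i ∈ Finset.univ.filter (fun i => x ∈ C i), w i
              + (Finset.univ.filter (fun i => x ∈ C i)).card := by
            rw [Finset.sum_add_distrib, ← Finset.mul_sum]; simp
        _ ≤ 27 * q ^ 2 * k * (1 / (2 * (27 * q ^ 2))) + Fintype.card ι := by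
            gcongr
            exact Finset.card_filter_le _ _
        _ = _ := by field_simp
    have h2 : (k : ℝ) + 1 ≤ E.card := by exact_mod_cast hE
    have h3 : (k : ℝ) = 2 * Fintype.card ι + 1 := by rw [hk]; push_cast; ring
    linarith
  obtain ⟨μ, hμ, s, hs, hμs⟩ :=
    exists_measure_forall_le_integral (by positivity : (0 : ℝ) < 1 / (2 * (27 * q ^ 2))) hK
  refine ⟨μ, hμ, ENNReal.ofReal s, by simpa using hs, fun C hC hε => ?_⟩
  have hcont : Continuous (C.indicator (1 : Cantor → ℝ)) :=
    hC.continuous_indicator continuous_one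
  have := hμs ⟨_, hcont⟩ ⟨C, hC, hε, fun x => rfl⟩
  rw [ContinuousMap.coe_mk, integral_indicator_one hC.isOpen.measurableSet] at this
  exact ENNReal.ofReal_le_of_le_toReal this

end Kelley

namespace Maharam

variable {φ : Set Cantor → ℝ≥0}

lemma tendsto_iUnion_diff (h : Maharam φ) {A : ℕ → Set Cantor} (hA : ∀ n, MeasurableSet (A n)) :
    Tendsto (fun N => φ ((⋃ n, A n) \ ⋃ n ∈ Finset.range N, A n)) atTop (nhds 0) := by
  have := h.2 (fun N => (⋃ n, A n) \ ⋃ n ∈ Finset.range N, A n)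
    (fun N => (MeasurableSet.iUnion hA).diff (Finset.measurableSet_biUnion _ fun n _ => hA n))
    (fun N M hNM => Set.sdiff_subset_sdiff_right
      (Set.biUnion_subset_biUnion_left fun n hn => by
        simp only [Finset.coe_range] at hn ⊢
        exact lt_of_lt_of_le hn hNM))
  have hempty : ⋂ N, ((⋃ n, A n) \ ⋃ n ∈ Finset.range N, A n) = ∅ := by
    rw [Set.eq_empty_iff_forall_notMem]
    intro x hx
    rw [Set.mem_iInter] at hx
    obtain ⟨n, hn⟩ := Set.mem_iUnion.1 (hx 0).1
    exact (hx (n + 1)).2 (Set.mem_biUnion (by simp) hn)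
  rwa [hempty, h.1.1] at this

/-- Countable subadditivity. -/
lemma iUnion_le (h : Maharam φ) {A : ℕ → Set Cantor} (hA : ∀ n, MeasurableSet (A n)) {c : ℝ≥0}
    (hc : ∀ N, ∑ n ∈ Finset.range N, φ (A n) ≤ c) : φ (⋃ n, A n) ≤ c := by
  have hlim := (h.tendsto_iUnion_diff hA).const_add c
  rw [add_zero] at hlim
  refine ge_of_tendsto' hlim fun N => ?_
  have hm : MeasurableSet (⋃ n ∈ Finset.range N, A n) :=
    Finset.measurableSet_biUnion _ fun n _ => hA n
  calc φ (⋃ n, A n)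
      ≤ φ ((⋃ n ∈ Finset.range N, A n) ∪ ((⋃ n, A n) \ ⋃ n ∈ Finset.range N, A n)) :=
        h.1.mono (.iUnion hA) (hm.union ((MeasurableSet.iUnion hA).diff hm))
          (fun x hx => by
            rw [Set.union_sdiff_self]
            exact Or.inr hx)
    _ ≤ φ (⋃ n ∈ Finset.range N, A n) + φ ((⋃ n, A n) \ ⋃ n ∈ Finset.range N, A n) :=
        h.1.union_le hm ((MeasurableSet.iUnion hA).diff hm)
    _ ≤ c + _ := add_le_add_left ((h.1.biUnion_le _ hA).trans (hc N)) _

lemma iUnion_eq_zero (h : Maharam φ) {A : ℕ → Set Cantor} (hA : ∀ n, MeasurableSet (A n))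
    (h0 : ∀ n, φ (A n) = 0) : φ (⋃ n, A n) = 0 :=
  le_antisymm (h.iUnion_le hA fun N => by simp [h0]) (zero_le)

lemma sum_range_half_pow_le (ε : ℝ≥0) (N : ℕ) :
    ∑ n ∈ Finset.range N, ε * (1 / 2) ^ (n + 1) ≤ ε := by
  have : ∀ N : ℕ, ∑ n ∈ Finset.range N, ε * (1 / 2) ^ (n + 1) + ε * (1 / 2) ^ N = ε := by
    intro N
    induction N with
    | zero => simp
    | succ N ih =>
      have hhalf : (1 / 2 : ℝ≥0) ^ (N + 1) + (1 / 2) ^ (N + 1) = (1 / 2) ^ N := by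
        rw [pow_succ, ← mul_add, add_halves, mul_one]
      rw [Finset.sum_range_succ, add_assoc, ← mul_add, hhalf, ih]
  exact le_of_le_of_eq le_self_add (this N)

/-- Borel sets can be approximated by closed subsets and open supersets. -/
lemma exists_isClosed_isOpen (h : Maharam φ) {B : Set Cantor} (hB : MeasurableSet B) :
    ∀ ε : ℝ≥0, 0 < ε → ∃ K U : Set Cantor, IsClosed K ∧ IsOpen U ∧ K ⊆ B ∧ B ⊆ U ∧
      φ (U \ K) ≤ ε := by
  induction B, hB using MeasurableSet.induction_on_open with
  | isOpen U hU =>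
    intro ε hε
    let hmet := TopologicalSpace.pseudoMetrizableSpacePseudoMetric Cantor
    obtain ⟨F, hFc, hFU, hFun, hFm⟩ := hU.exists_iUnion_isClosed
    obtain ⟨N, hN⟩ := ((h.tendsto_iUnion_diff fun n => (hFc n).measurableSet).eventually
      (ge_mem_nhds hε)).exists
    refine ⟨⋃ n ∈ Finset.range N, F n, U, isClosed_biUnion_finset fun n _ => hFc n, hU,
      Set.iUnion₂_subset fun n _ => hFU n, subset_rfl, ?_⟩
    rwa [hFun] at hN
  | compl B hB ih =>
    intro ε hε
    obtain ⟨K, U, hK, hU, hKB, hBU, hφ⟩ := ih ε hε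
    refine ⟨Uᶜ, Kᶜ, hU.isClosed_compl, hK.isOpen_compl, Set.compl_subset_compl.2 hBU,
      Set.compl_subset_compl.2 hKB, ?_⟩
    have : Kᶜ \ Uᶜ = U \ K := by
      ext x
      simp [and_comm]
    rwa [this]
  | iUnion A _ hA ih =>
    intro ε hε
    have hε2 : 0 < ε / 2 := half_pos hε
    choose K U hK hU hKA hAU hφ using fun n => ih n (ε / 2 * (1 / 2) ^ (n + 1)) (by positivity)
    have hKm := fun n => (hK n).measurableSet
    have hUm := fun n => (hU n).measurableSet
    obtain ⟨N, hN⟩ := ((h.tendsto_iUnion_diff hKm).eventually (ge_mem_nhds hε2)).exists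
    have hNm : MeasurableSet (⋃ n ∈ Finset.range N, K n) :=
      Finset.measurableSet_biUnion _ fun n _ => hKm n
    refine ⟨⋃ n ∈ Finset.range N, K n, ⋃ n, U n, isClosed_biUnion_finset fun n _ => hK n,
      isOpen_iUnion hU, Set.iUnion₂_subset fun n _ => (hKA n).trans (Set.subset_iUnion A n),
      Set.iUnion_mono hAU, ?_⟩
    calc φ ((⋃ n, U n) \ ⋃ n ∈ Finset.range N, K n)
        ≤ φ ((⋃ n, U n \ K n) ∪ ((⋃ n, K n) \ ⋃ n ∈ Finset.range N, K n)) := by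
          refine h.1.mono ((MeasurableSet.iUnion hUm).diff hNm)
            ((MeasurableSet.iUnion fun n => (hUm n).diff (hKm n)).union
              ((MeasurableSet.iUnion hKm).diff hNm)) ?_
          rintro x ⟨hx, hxN⟩
          by_cases hxK : x ∈ ⋃ n, K n
          · exact Or.inr ⟨hxK, hxN⟩
          · obtain ⟨n, hn⟩ := Set.mem_iUnion.1 hx
            exact Or.inl (Set.mem_iUnion.2 ⟨n, hn, fun hk => hxK (Set.mem_iUnion.2 ⟨n, hk⟩)⟩)
      _ ≤ φ (⋃ n, U n \ K n) + φ ((⋃ n, K n) \ ⋃ n ∈ Finset.range N, K n) :=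
          h.1.union_le (MeasurableSet.iUnion fun n => (hUm n).diff (hKm n))
            ((MeasurableSet.iUnion hKm).diff hNm)
      _ ≤ ε / 2 + ε / 2 := by
          refine add_le_add (h.iUnion_le (fun n => (hUm n).diff (hKm n)) fun M => ?_) hN
          exact (Finset.sum_le_sum fun n _ => hφ n).trans (sum_range_half_pow_le _ M)
      _ = ε := add_halves ε

end Maharam

/-- The sequence of clopen hulls of a subset of Cantor space. -/
def clopenHull (K : Set Cantor) (n : ℕ) : Set Cantor :=
  {x | ∃ y ∈ K, ∀ i : Fin n, x i = y i}

lemma isClopen_clopenHull (K : Set Cantor) (n : ℕ) : IsClopen (clopenHull K n) := by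
  have hcont : Continuous fun (x : Cantor) (i : Fin n) => x i := by fun_prop
  have : clopenHull K n = (fun (x : Cantor) (i : Fin n) => x i) ⁻¹'
      ((fun (x : Cantor) (i : Fin n) => x i) '' K) := by
    ext x
    simp only [clopenHull, Set.mem_ofPred_eq, Set.mem_preimage, Set.mem_image, funext_iff]
    exact exists_congr fun y => and_congr_right fun _ => forall_congr' fun i => eq_comm
  rw [this]
  exact (isClopen_discrete _).preimage hcont

lemma antitone_clopenHull (K : Set Cantor) : Antitone (clopenHull K) := by
  rintro n m hnm x ⟨y, hy, hxy⟩
  exact ⟨y, hy, fun i => hxy (Fin.castLE hnm i)⟩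

lemma subset_clopenHull (K : Set Cantor) (n : ℕ) : K ⊆ clopenHull K n :=
  fun x hx => ⟨x, hx, fun _ => rfl⟩

lemma iInter_clopenHull {K : Set Cantor} (hK : IsClosed K) : ⋂ n, clopenHull K n = K := by
  refine subset_antisymm (fun x hx => ?_) (Set.subset_iInter (subset_clopenHull K))
  choose y hy hxy using fun n => Set.mem_iInter.1 hx n
  refine hK.mem_of_tendsto (f := y) (b := atTop) (tendsto_pi_nhds.2 fun i => ?_) (Eventually.of_forall hy)
  refine tendsto_const_nhds.congr' ?_
  filter_upwards [eventually_gt_atTop i] with n hn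
  exact hxy n ⟨i, hn⟩

section ControlMeasure

open MeasureTheory

variable {φ : Set Cantor → ℝ≥0}

/-- A measure controlling a Maharam submeasure at level `ε` on clopen sets controls it at level
`2 ε` on Borel sets. -/
lemma Maharam.measure_pos_of_forall_isClopen (h : Maharam φ) {μ : Measure Cantor}
    [IsFiniteMeasure μ] {s : ENNReal} (hs : 0 < s) {ε : ℝ≥0} (hε : 0 < ε)
    (hμ : ∀ C, IsClopen C → ε ≤ φ C → s ≤ μ C) {B : Set Cantor} (hB : MeasurableSet B)
    (hφB : 2 * ε ≤ φ B) : 0 < μ B := by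
  obtain ⟨K, U, hK, hU, hKB, hBU, hUK⟩ := h.exists_isClosed_isOpen hB ε hε
  have hKm := hK.measurableSet
  have hφK : ε ≤ φ K := by
    have : φ B ≤ φ K + ε := by
      calc φ B ≤ φ (K ∪ U \ K) := h.1.mono hB (hKm.union (hU.measurableSet.diff hKm))
            (by rw [Set.union_sdiff_self]; exact hBU.trans Set.subset_union_right)
        _ ≤ φ K + φ (U \ K) := h.1.union_le hKm (hU.measurableSet.diff hKm)
        _ ≤ _ := add_le_add_right hUK _
    rw [two_mul] at hφB
    exact le_of_add_le_add_right (hφB.trans this)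
  have hm := fun n => (isClopen_clopenHull K n).isOpen.measurableSet
  have hlim := tendsto_measure_iInter_atTop (μ := μ) (fun n => (hm n).nullMeasurableSet)
    (antitone_clopenHull K) ⟨0, measure_ne_top μ _⟩
  rw [iInter_clopenHull hK] at hlim
  have : s ≤ μ K := ge_of_tendsto' hlim fun n => hμ _ (isClopen_clopenHull K n)
    (hφK.trans (h.1.mono hKm (hm n) (subset_clopenHull K n)))
  exact hs.trans_le (this.trans (measure_mono hKB))

/-- If every set null for a finite measure is null for a Maharam submeasure, then the submeasure
has a control measure. -/
lemma Maharam.exists_control_of_null (h : Maharam φ) (μ : Measure Cantor) [IsFiniteMeasure μ]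
    (hμ : ∀ B, MeasurableSet B → μ B = 0 → φ B = 0) :
    ∃ ν : Measure Cantor, IsFiniteMeasure ν ∧ ∀ C, MeasurableSet C → (ν C = 0 ↔ φ C = 0) := by
  let S : Set ENNReal := {a | ∃ N, MeasurableSet N ∧ φ N = 0 ∧ μ N = a}
  have hS : S.Nonempty := ⟨0, ∅, .empty, h.1.1, measure_empty⟩
  obtain ⟨u, -, hu, huS⟩ := exists_seq_tendsto_sSup hS (OrderTop.bddAbove S)
  choose N hNm hN0 hNu using huS
  have hM : MeasurableSet (⋃ n, N n) := .iUnion hNm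
  have hM0 : φ (⋃ n, N n) = 0 := h.iUnion_eq_zero hNm hN0
  have hMsup : sSup S ≤ μ (⋃ n, N n) :=
    le_of_tendsto' hu fun n => (hNu n).symm.le.trans (measure_mono (Set.subset_iUnion N n))
  refine ⟨μ.restrict (⋃ n, N n)ᶜ, inferInstance, fun C hC => ?_⟩
  rw [Measure.restrict_apply hC, ← Set.sdiff_eq]
  have hCM : MeasurableSet (C \ ⋃ n, N n) := hC.diff hM
  have hle : φ C ≤ φ (⋃ n, N n) + φ (C \ ⋃ n, N n) :=
    (h.1.mono hC (hM.union hCM) (by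
      rw [Set.union_sdiff_self]; exact Set.subset_union_right)).trans (h.1.union_le hM hCM)
  constructor
  · intro hzero
    rw [hM0, hμ _ hCM hzero, add_zero] at hle
    exact le_antisymm hle (zero_le)
  · intro hzero
    have h0 : φ ((⋃ n, N n) ∪ (C \ ⋃ n, N n)) = 0 := by
      refine le_antisymm ((h.1.union_le hM hCM).trans ?_) (zero_le)
      rw [hM0, zero_add]
      exact (h.1.mono hCM hC Set.sdiff_subset).trans hzero.le
    have h1 : μ ((⋃ n, N n) ∪ (C \ ⋃ n, N n)) ≤ μ (⋃ n, N n) :=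
      (le_sSup ⟨_, hM.union hCM, h0, rfl⟩ : _ ≤ sSup S).trans hMsup
    rw [measure_union Set.disjoint_sdiff_right hCM] at h1
    have h2 : μ (⋃ n, N n) + μ (C \ ⋃ n, N n) ≤ μ (⋃ n, N n) + 0 := by rwa [add_zero]
    exact le_antisymm ((ENNReal.add_le_add_iff_left (measure_ne_top μ _)).1 h2) (zero_le)

/-- The Kalton–Roberts theorem for Maharam submeasures: without a control measure there are
arbitrarily many disjoint sets of submeasure bounded away from zero. -/
lemma Maharam.exists_disjoint_of_no_control (h : Maharam φ)
    (hno : ¬ ∃ μ : Measure Cantor, IsFiniteMeasure μ ∧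
      ∀ C : Set Cantor, MeasurableSet C → (μ C = 0 ↔ φ C = 0)) :
    ∃ c : ℝ≥0, 0 < c ∧ ∀ q : ℕ, 0 < q → ∃ D : Fin q → Set Cantor, (∀ i, MeasurableSet (D i)) ∧
      Pairwise (fun i j => Disjoint (D i) (D j)) ∧ ∀ i, c ≤ φ (D i) := by
  by_contra! hcon
  apply hno
  have hex : ∀ n : ℕ, ∃ μ : Measure Cantor, IsFiniteMeasure μ ∧ ∃ s : ENNReal, 0 < s ∧
      ∀ C, IsClopen C → (1 / (n + 1) : ℝ≥0) ≤ φ C → s ≤ μ C := by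
    intro n
    obtain ⟨q, hq, hD⟩ := hcon ((1 / (n + 1)) / 3) (by positivity)
    refine h.1.exists_measure_forall_isClopen hq ?_
    rintro ⟨D, hD1, hD2, hD3⟩
    obtain ⟨i, hi⟩ := hD D hD1 hD2
    exact absurd (hD3 i) (not_le.2 hi)
  choose μ hfin s hs hμ using hex
  let a : ℕ → ENNReal := fun n => (2⁻¹ : ENNReal) ^ (n + 1) / (μ n Set.univ + 1)
  have hdenom : ∀ n, μ n Set.univ + 1 ≠ ⊤ := fun n =>
    ENNReal.add_ne_top.2 ⟨measure_ne_top _ _, ENNReal.one_ne_top⟩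
  have ha : ∀ n, a n ≠ 0 := fun n =>
    (ENNReal.div_pos (by simp) (hdenom n)).ne'
  let ν : Measure Cantor := Measure.sum fun n => a n • μ n
  have hν : IsFiniteMeasure ν := by
    refine ⟨?_⟩
    rw [Measure.sum_apply _ .univ]
    refine lt_of_le_of_lt (ENNReal.tsum_le_tsum (g := fun n => (2⁻¹ : ENNReal) ^ (n + 1))
      fun n => ?_) ?_
    · rw [Measure.smul_apply, smul_eq_mul]
      calc a n * μ n Set.univ ≤ a n * (μ n Set.univ + 1) := by gcongr; exact le_self_add
        _ = _ := ENNReal.div_mul_cancel (by simp) (hdenom n)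
    · rw [ENNReal.tsum_geometric_add_one]
      exact ENNReal.mul_lt_top (by simp) (by simp)
  refine h.exists_control_of_null ν fun B hB hνB => ?_
  by_contra hφB
  obtain ⟨n, hn⟩ := exists_nat_one_div_lt
    (show (0 : ℝ≥0) < φ B / 2 from half_pos (pos_iff_ne_zero.2 hφB))
  have hpos := h.measure_pos_of_forall_isClopen (hs n) (by positivity) (hμ n) hB (by
    rw [lt_div_iff₀ two_pos, mul_comm] at hn
    exact hn.le)
  rw [Measure.sum_apply _ hB, ENNReal.tsum_eq_zero] at hνB
  have := hνB n
  rw [Measure.smul_apply, smul_eq_mul, mul_eq_zero] at this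
  exact this.elim (ha n) hpos.ne'

end ControlMeasure

lemma Maharam.exists_finite_cover {ψ : Set Cantor → ℝ≥0} (h : Maharam ψ) (hd : Diffuse ψ)
    {ε : ℝ≥0} (hε : 0 < ε) :
    ∃ q : ℕ, 0 < q ∧ ∃ Y : Fin q → Set Cantor, (∀ i, MeasurableSet (Y i)) ∧
      (∀ i, ψ (Y i) ≤ ε) ∧ ∀ y, ∃ i, y ∈ Y i := by
  have hex : ∀ x : Cantor, ∃ n, ψ (clopenHull {x} n) ≤ ε := by
    intro x
    have := h.2 (clopenHull {x}) (fun n => (isClopen_clopenHull _ n).isOpen.measurableSet)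
      (antitone_clopenHull _)
    rw [iInter_clopenHull isClosed_singleton, hd x] at this
    exact (this.eventually (ge_mem_nhds hε)).exists
  choose n hn using hex
  obtain ⟨t, ht⟩ := isCompact_univ.elim_finite_subcover (fun x : Cantor => clopenHull {x} (n x))
    (fun x => (isClopen_clopenHull _ _).isOpen)
    (fun x _ => Set.mem_iUnion.2 ⟨x, subset_clopenHull _ _ rfl⟩)
  have hcov : ∀ y, ∃ i, y ∈ clopenHull {(t.equivFin.symm i : Cantor)} (n (t.equivFin.symm i)) := by
    intro y
    obtain ⟨x, hx, hy⟩ := Set.mem_iUnion₂.1 (ht (Set.mem_univ y))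
    exact ⟨t.equivFin ⟨x, hx⟩, by simpa using hy⟩
  refine ⟨t.card, ?_, fun i => clopenHull {(t.equivFin.symm i : Cantor)} (n (t.equivFin.symm i)),
    fun i => (isClopen_clopenHull _ _).isOpen.measurableSet, fun i => hn _, hcov⟩
  obtain ⟨i, -⟩ := hcov fun _ => false
  exact i.pos

/-- If `φ, ψ` are diffuse Maharam submeasures and `φ` has no control measure,
then there is a Borel `A ⊆ 2^ℕ × 2^ℕ` with all vertical sections `ψ`-null and
`inf_y φ(A^y) > 0`. -/
theorem stmt11 (φ ψ : Set Cantor → ℝ≥0)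
    (hφ : Maharam φ) (hφd : Diffuse φ)
    (hψ : Maharam ψ) (hψd : Diffuse ψ)
    (hnoctrl : ¬ ∃ μ : MeasureTheory.Measure Cantor, MeasureTheory.IsFiniteMeasure μ ∧
      ∀ C : Set Cantor, MeasurableSet C → (μ C = 0 ↔ φ C = 0)) :
    ∃ A : Set (Cantor × Cantor), MeasurableSet A ∧
      (∀ x : Cantor, ψ {y | (x, y) ∈ A} = 0) ∧
      0 < ⨅ y : Cantor, φ {x | (x, y) ∈ A} := by
  obtain ⟨c, hc, hD⟩ := hφ.exists_disjoint_of_no_control hnoctrl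
  have hstep : ∀ n : ℕ, ∃ A : Set (Cantor × Cantor), MeasurableSet A ∧
      (∀ x, ψ {y | (x, y) ∈ A} ≤ (1 / 2) ^ n) ∧ ∀ y, c ≤ φ {x | (x, y) ∈ A} := by
    intro n
    obtain ⟨q, hq, Y, hYm, hYψ, hY⟩ := hψ.exists_finite_cover hψd
      (by positivity : (0 : ℝ≥0) < (1 / 2) ^ n)
    obtain ⟨D, hDm, hDd, hDc⟩ := hD q hq
    have hA : MeasurableSet (⋃ i, D i ×ˢ Y i) := .iUnion fun i => (hDm i).prod (hYm i)
    refine ⟨⋃ i, D i ×ˢ Y i, hA, fun x => ?_, fun y => ?_⟩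
    · by_cases hx : ∃ i, x ∈ D i
      · obtain ⟨i, hi⟩ := hx
        refine (hψ.1.mono (hA.preimage measurable_prodMk_left) (hYm i) ?_).trans (hYψ i)
        intro y hy
        obtain ⟨j, hj, hyj⟩ := Set.mem_iUnion.1 hy
        have : i = j := by
          by_contra hij
          exact Set.disjoint_left.1 (hDd hij) hi hj
        exact this ▸ hyj
      · have : {y | (x, y) ∈ ⋃ i, D i ×ˢ Y i} = ∅ := by
          rw [Set.eq_empty_iff_forall_notMem]
          intro y hy
          obtain ⟨j, hj, -⟩ := Set.mem_iUnion.1 hy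
          exact hx ⟨j, hj⟩
        rw [this, hψ.1.1]
        exact zero_le
    · obtain ⟨i, hi⟩ := hY y
      exact (hDc i).trans (hφ.1.mono (hDm i) (hA.preimage measurable_prodMk_right)
        fun x hx => Set.mem_iUnion.2 ⟨i, hx, hi⟩)
  choose A hAm hAψ hAφ using hstep
  have hTm : ∀ m, MeasurableSet (⋃ n, A (m + n)) := fun m => .iUnion fun n => hAm _
  have hBm : MeasurableSet (⋂ m, ⋃ n, A (m + n)) := .iInter hTm
  refine ⟨⋂ m, ⋃ n, A (m + n), hBm, fun x => ?_, hc.trans_le (le_ciInf fun y => ?_)⟩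
  · have hle : ∀ m, ψ {y | (x, y) ∈ ⋂ m, ⋃ n, A (m + n)} ≤ 2 * (1 / 2) ^ m := by
      intro m
      have hsec : ∀ n, MeasurableSet {y | (x, y) ∈ A (m + n)} := fun n =>
        (hAm _).preimage measurable_prodMk_left
      refine (hψ.1.mono (hBm.preimage measurable_prodMk_left) (.iUnion hsec) ?_).trans
        (hψ.iUnion_le hsec fun N => ?_)
      · intro y hy
        simpa using Set.mem_iInter.1 hy m
      · refine le_trans (Finset.sum_le_sum fun n _ => ?_)
          (Maharam.sum_range_half_pow_le (2 * (1 / 2) ^ m) N)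
        refine (hAψ (m + n) x).trans (le_of_eq ?_)
        rw [pow_add, pow_succ]
        field_simp
    have hlim : Tendsto (fun m : ℕ => 2 * (1 / 2 : ℝ≥0) ^ m) atTop (nhds 0) := by
      have := (tendsto_pow_atTop_nhds_zero_of_lt_one (zero_le : (0 : ℝ≥0) ≤ 1 / 2)
        (half_lt_self one_pos)).const_mul 2
      rwa [mul_zero] at this
    exact le_antisymm (ge_of_tendsto' hlim hle) zero_le
  · have hlim := hφ.2 (fun m => {x | (x, y) ∈ ⋃ n, A (m + n)})
      (fun m => (hTm m).preimage measurable_prodMk_right) (by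
        intro m m' hmm x hx
        obtain ⟨n, hn⟩ := Set.mem_iUnion.1 hx
        obtain ⟨d, rfl⟩ := Nat.exists_eq_add_of_le hmm
        exact Set.mem_iUnion.2 ⟨d + n, by rwa [← add_assoc]⟩)
    have hset : {x | (x, y) ∈ ⋂ m, ⋃ n, A (m + n)} = ⋂ m, {x | (x, y) ∈ ⋃ n, A (m + n)} := by
      ext x
      simp
    rw [hset]
    refine ge_of_tendsto' hlim fun m => (hAφ m y).trans (hφ.1.mono
      ((hAm m).preimage measurable_prodMk_right) ((hTm m).preimage measurable_prodMk_right) ?_)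
    exact fun x hx => Set.mem_iUnion.2 ⟨0, hx⟩
end

section
/- Let φ be a diffuse Maharam submeasure on the Borel subsets of Cantor space 2^ℕ. Then for every Borel set A and every real ε with 0 ≤ ε ≤ φ(A) there is a Borel set B ⊆ A with φ(B) = ε. -/
open Set Filter NNReal

/-- Fibres of an injective measurable real function have thickenings of arbitrarily small
submeasure. -/
lemma exists_thickening_lt (φ : Set Cantor → ℝ≥0) (hφ : Maharam φ) (hd : Diffuse φ)
    {f : Cantor → ℝ} (hf : Measurable f) (hinj : Function.Injective f) (t η : ℝ) (hη : 0 < η) :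
    ∃ δ > 0, (φ {x | |f x - t| ≤ δ} : ℝ) < η := by
  obtain ⟨⟨h0, hmono, -⟩, hcont⟩ := hφ
  have hmeas : ∀ n : ℕ, MeasurableSet {x | |f x - t| ≤ 1 / ((n : ℝ) + 1)} := fun n =>
    measurableSet_le (by fun_prop) measurable_const
  have hanti : Antitone fun n : ℕ => {x | |f x - t| ≤ 1 / ((n : ℝ) + 1)} := fun m n hmn x hx =>
    show |f x - t| ≤ 1 / ((m : ℝ) + 1) from le_trans hx (Nat.one_div_le_one_div hmn)
  have hsub : (⋂ n : ℕ, {x | |f x - t| ≤ 1 / ((n : ℝ) + 1)}) ⊆ {x | f x = t} := by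
    intro x hx
    have hx' : ∀ n : ℕ, |f x - t| ≤ 1 / ((n : ℝ) + 1) := mem_iInter.mp hx
    have h : |f x - t| ≤ 0 :=
      ge_of_tendsto tendsto_one_div_add_atTop_nhds_zero_nat (Eventually.of_forall hx')
    exact sub_eq_zero.mp (abs_nonpos_iff.mp h)
  have hfib : φ {x | f x = t} = 0 := by
    by_cases ht : ∃ x, f x = t
    · obtain ⟨x, rfl⟩ := ht
      have : {y | f y = f x} = {x} := by
        ext y
        exact hinj.eq_iff
      rw [this, hd]
    · have : {x | f x = t} = ∅ := by
        ext y
        simpa using fun h => ht ⟨y, h⟩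
      rw [this, h0]
  have hzero : φ (⋂ n : ℕ, {x | |f x - t| ≤ 1 / ((n : ℝ) + 1)}) = 0 :=
    le_antisymm (hfib ▸ hmono _ _ (MeasurableSet.iInter hmeas)
      (measurableSet_eq_fun hf measurable_const) hsub) zero_le
  have hlim := hcont _ hmeas hanti
  rw [hzero] at hlim
  obtain ⟨n, hn⟩ := (hlim.eventually_lt_const (u := ⟨η, hη.le⟩) hη).exists
  exact ⟨1 / ((n : ℝ) + 1), by positivity, hn⟩

/-- The distribution function of a diffuse Maharam submeasure along an injective measurable real
function is continuous. -/
lemma continuous_submeasure_sublevel (φ : Set Cantor → ℝ≥0) (hφ : Maharam φ) (hd : Diffuse φ)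
    {f : Cantor → ℝ} (hf : Measurable f) (hinj : Function.Injective f)
    {A : Set Cantor} (hA : MeasurableSet A) :
    Continuous fun t : ℝ => φ (A ∩ {x | f x ≤ t}) := by
  have hS : ∀ t, MeasurableSet (A ∩ {x | f x ≤ t}) := fun t =>
    hA.inter (measurableSet_le hf measurable_const)
  have key : ∀ t δ r s : ℝ, |r - t| ≤ δ → |s - t| ≤ δ →
      (φ (A ∩ {x | f x ≤ r}) : ℝ) ≤ φ (A ∩ {x | f x ≤ s}) + φ {x | |f x - t| ≤ δ} := by
    intro t δ r s hr hs
    have hT : MeasurableSet {x | |f x - t| ≤ δ} :=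
      measurableSet_le (by fun_prop) measurable_const
    have hsub : A ∩ {x | f x ≤ r} ⊆ A ∩ {x | f x ≤ s} ∪ {x | |f x - t| ≤ δ} := by
      rintro x ⟨hxA, hx⟩
      rcases le_or_gt (f x) s with h | h
      · exact Or.inl ⟨hxA, h⟩
      · right
        simp only [mem_ofPred_eq, abs_le] at *
        constructor <;> linarith
    exact_mod_cast (hφ.1.2.1 _ _ (hS r) ((hS s).union hT) hsub).trans
      (hφ.1.2.2 _ _ (hS s) hT)
  rw [Metric.continuous_iff]
  intro t η hη
  obtain ⟨δ, hδ, hlt⟩ := exists_thickening_lt φ hφ hd hf hinj t η hη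
  refine ⟨δ, hδ, fun s hs => ?_⟩
  rw [Real.dist_eq] at hs
  have ht : |t - t| ≤ δ := by simpa using hδ.le
  have h₁ := key t δ s t hs.le ht
  have h₂ := key t δ t s ht hs.le
  rw [NNReal.dist_eq, abs_lt]
  constructor <;> linarith

/-- A diffuse Maharam submeasure takes all intermediate values: for every Borel
`A` and every `ε` with `0 ≤ ε ≤ φ(A)` there is a Borel `B ⊆ A` with
`φ(B) = ε`. -/
theorem stmt12 (φ : Set Cantor → ℝ≥0) (hφ : Maharam φ) (hd : Diffuse φ)
    (A : Set Cantor) (hA : MeasurableSet A) (ε : ℝ≥0) (hε : ε ≤ φ A) :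
    ∃ B : Set Cantor, MeasurableSet B ∧ B ⊆ A ∧ φ B = ε := by
  let f : Cantor → ℝ := fun x => Real.arctan (MeasureTheory.embeddingReal Cantor x)
  have hf : Measurable f :=
    Real.measurable_arctan.comp (MeasureTheory.measurableEmbedding_embeddingReal Cantor).measurable
  have hinj : Function.Injective f :=
    Real.arctan_injective.comp (MeasureTheory.measurableEmbedding_embeddingReal Cantor).injective
  have hlow : A ∩ {x | f x ≤ -(Real.pi / 2)} = ∅ := by
    ext x
    simp [f, Real.neg_pi_div_two_lt_arctan]
  have hhigh : A ∩ {x | f x ≤ Real.pi / 2} = A :=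
    inter_eq_left.mpr fun x _ => (Real.arctan_lt_pi_div_two _).le
  obtain ⟨t, ht⟩ := mem_range_of_exists_le_of_exists_ge
    (continuous_submeasure_sublevel φ hφ hd hf hinj hA)
    (c := ε) ⟨-(Real.pi / 2), by simp only [hlow, hφ.1.1, zero_le]⟩
    ⟨Real.pi / 2, by simpa only [hhigh] using hε⟩
  exact ⟨_, hA.inter (measurableSet_le hf measurable_const), inter_subset_left, ht⟩
end

section
/- Let φ be a diffuse Maharam submeasure on the Borel subsets of Cantor space 2^ℕ. Then there is a Borel set D ⊆ 2^ℕ × 2^ℕ such that for every x ∈ 2^ℕ the vertical section D_x = {y : (x,y) ∈ D} satisfies φ(D_x) = 0, and for every y ∈ 2^ℕ the set {x : (x,y) ∉ D} is meager in 2^ℕ. -/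
open Set Filter NNReal

/-- The points agreeing with the first `m` values of `x` form a clopen set. -/
theorem Cantor.isClopen_cylinder (x : Cantor) (m : ℕ) :
    IsClopen {y : Cantor | ∀ i < m, y i = x i} := by
  have h : {y : Cantor | ∀ i < m, y i = x i} = ⋂ i ∈ Finset.range m, {y : Cantor | y i = x i} := by
    ext y; simp
  rw [h]
  exact isClopen_biInter_finset fun i _ =>
    (isClopen_discrete {x i}).preimage (continuous_apply i : Continuous fun y : Cantor => y i)

/-- Countable subadditivity of a Maharam submeasure, with a geometric bound on the pieces. -/
theorem Maharam.iUnion_le_s15 {φ : Set Cantor → ℝ≥0} (hφ : Maharam φ) {A : ℕ → Set Cantor}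
    (hA : ∀ k, MeasurableSet (A k)) {ε : ℝ≥0} (hε : ∀ k, φ (A k) ≤ ε * (1 / 2) ^ (k + 1)) :
    φ (⋃ k, A k) ≤ ε := by
  obtain ⟨⟨h0, hmono, hsub⟩, hcont⟩ := hφ
  have hP : ∀ N, MeasurableSet (⋃ k < N, A k) := fun N =>
    MeasurableSet.iUnion fun k => MeasurableSet.iUnion fun _ => hA k
  have hU : MeasurableSet (⋃ k, A k) := MeasurableSet.iUnion hA
  have hfin : ∀ N, φ (⋃ k < N, A k) + ε * (1 / 2) ^ N ≤ ε := by
    intro N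
    induction N with
    | zero => simp [h0]
    | succ N ih =>
      rw [biUnion_lt_succ]
      calc φ ((⋃ k < N, A k) ∪ A N) + ε * (1 / 2) ^ (N + 1)
          ≤ (φ (⋃ k < N, A k) + ε * (1 / 2) ^ (N + 1)) + ε * (1 / 2) ^ (N + 1) := by
            gcongr
            exact (hsub _ _ (hP N) (hA N)).trans (by gcongr; exact hε N)
        _ = φ (⋃ k < N, A k) + ε * (1 / 2) ^ N := by
            rw [pow_succ, add_assoc, ← mul_add, ← mul_add, add_halves, mul_one]
        _ ≤ ε := ih
  have htail : Tendsto (fun N => φ ((⋃ k, A k) \ ⋃ k < N, A k)) atTop (nhds 0) := by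
    have h := hcont (fun N => (⋃ k, A k) \ ⋃ k < N, A k) (fun N => hU.diff (hP N))
      (fun M N hMN => sdiff_subset_sdiff_right
        (biUnion_subset_biUnion_left fun k (hk : k < M) => hk.trans_le hMN))
    have hempty : ⋂ N, ((⋃ k, A k) \ ⋃ k < N, A k) = ∅ := by
      refine eq_empty_of_forall_notMem fun x hx => ?_
      rw [mem_iInter] at hx
      obtain ⟨k, hk⟩ := mem_iUnion.1 (hx 0).1
      exact (hx (k + 1)).2 (mem_biUnion (Nat.lt_succ_self k) hk)
    rwa [hempty, h0] at h
  have hlim : Tendsto (fun N => ε + φ ((⋃ k, A k) \ ⋃ k < N, A k)) atTop (nhds (ε + 0)) :=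
    tendsto_const_nhds.add htail
  rw [add_zero] at hlim
  refine ge_of_tendsto' hlim fun N => ?_
  calc φ (⋃ k, A k) ≤ φ ((⋃ k < N, A k) ∪ ((⋃ k, A k) \ ⋃ k < N, A k)) :=
        hmono _ _ hU ((hP N).union (hU.diff (hP N))) (by rw [union_sdiff_self]; exact subset_union_right)
    _ ≤ φ (⋃ k < N, A k) + φ ((⋃ k, A k) \ ⋃ k < N, A k) := hsub _ _ (hP N) (hU.diff (hP N))
    _ ≤ ε + φ ((⋃ k, A k) \ ⋃ k < N, A k) := by
        gcongr
        exact le_self_add.trans (hfin N)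

/-- For a diffuse Maharam submeasure, sufficiently long cylinders are uniformly small. -/
theorem Maharam.exists_cylinder_lt {φ : Set Cantor → ℝ≥0} (hφ : Maharam φ) (hd : Diffuse φ)
    {ε : ℝ≥0} (hε : 0 < ε) : ∃ m : ℕ, ∀ x : Cantor, φ {y | ∀ i < m, y i = x i} < ε := by
  by_contra! hbad
  have hclosed : ∀ m, IsClosed {x : Cantor | ε ≤ φ {y | ∀ i < m, y i = x i}} := by
    intro m
    have hloc : IsLocallyConstant fun x : Cantor => φ {y | ∀ i < m, y i = x i} := by
      refine (IsLocallyConstant.iff_exists_open _).2 fun x =>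
        ⟨_, (Cantor.isClopen_cylinder x m).isOpen, fun _ _ => rfl, fun z hz => ?_⟩
      have : {y : Cantor | ∀ i < m, y i = z i} = {y | ∀ i < m, y i = x i} := by
        ext y
        exact forall₂_congr fun i hi => by rw [hz i hi]
      rw [this]
    exact isClosed_le continuous_const hloc.continuous
  obtain ⟨x, hx⟩ := IsCompact.nonempty_iInter_of_sequence_nonempty_isCompact_isClosed
    (fun m => {x : Cantor | ε ≤ φ {y | ∀ i < m, y i = x i}})
    (fun m x hx => le_trans hx (hφ.1.2.1 _ _ (Cantor.isClopen_cylinder x _).isOpen.measurableSet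
      (Cantor.isClopen_cylinder x _).isOpen.measurableSet fun y hy i hi => hy i (Nat.lt_succ_of_lt hi)))
    hbad (hclosed 0).isCompact hclosed
  rw [mem_iInter] at hx
  have hlim := hφ.2 (fun m => {y : Cantor | ∀ i < m, y i = x i})
    (fun m => (Cantor.isClopen_cylinder x m).isOpen.measurableSet)
    (fun m n hmn y hy i hi => hy i (hi.trans_le hmn))
  have hsingle : ⋂ m, {y : Cantor | ∀ i < m, y i = x i} = {x} := by
    ext y
    simp only [mem_iInter, mem_ofPred_eq, mem_singleton_iff]
    exact ⟨fun h => funext fun i => h (i + 1) i i.lt_succ_self, fun h _ i _ => by rw [h]⟩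
  rw [hsingle, hd x] at hlim
  exact absurd (ge_of_tendsto' hlim hx) (not_le.2 hε)

/-- The pairs `(x, y)` such that an initial segment of `y` of length `m k` occurs in `x` at
position `k`, for some `k`, form an open set. -/
theorem Cantor.isOpen_setOf_exists_block (m : ℕ → ℕ) :
    IsOpen {p : Cantor × Cantor | ∃ k, ∀ i < m k, p.2 i = p.1 (k + i)} := by
  have h : {p : Cantor × Cantor | ∃ k, ∀ i < m k, p.2 i = p.1 (k + i)} =
      ⋃ k, ⋂ i ∈ Finset.range (m k), {p : Cantor × Cantor | p.2 i = p.1 (k + i)} := by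
    ext p; simp
  rw [h]
  refine isOpen_iUnion fun k => isOpen_biInter_finset fun i _ => ?_
  have hc : Continuous fun p : Cantor × Cantor => (p.2 i, p.1 (k + i)) := by fun_prop
  exact (isOpen_discrete {q : Bool × Bool | q.1 = q.2}).preimage hc

/-- For fixed `y`, the points `x` containing such an initial segment of `y` are dense. -/
theorem Cantor.dense_setOf_exists_block (m : ℕ → ℕ) (y : Cantor) :
    Dense {x : Cantor | ∃ k, ∀ i < m k, y i = x (k + i)} := by
  intro x
  let z : ℕ → Cantor := fun k j => if j < k then x j else y (j - k)
  have hz : Tendsto z atTop (nhds x) := by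
    refine tendsto_pi_nhds.2 fun j => tendsto_const_nhds.congr' ?_
    filter_upwards [eventually_gt_atTop j] with k hk
    simp [z, hk]
  exact mem_closure_of_tendsto hz (Eventually.of_forall fun k => ⟨k, fun i _ => by simp [z]⟩)

/-- For a diffuse Maharam submeasure `φ` there is a Borel `D ⊆ 2^ℕ × 2^ℕ` whose
vertical sections are all `φ`-null and such that the complement of every
horizontal section is meager. -/
theorem stmt15 (φ : Set Cantor → ℝ≥0) (hφ : Maharam φ) (hd : Diffuse φ) :
    ∃ D : Set (Cantor × Cantor), MeasurableSet D ∧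
      (∀ x : Cantor, φ {y | (x, y) ∈ D} = 0) ∧
      (∀ y : Cantor, IsMeagre {x : Cantor | (x, y) ∉ D}) := by
  have hex : ∀ n k : ℕ, ∃ m : ℕ, ∀ x : Cantor,
      φ {y | ∀ i < m, y i = x i} < (1 / 2) ^ n * (1 / 2) ^ (k + 1) :=
    fun n k => hφ.exists_cylinder_lt hd (by positivity)
  choose m hm using hex
  have hmeas : MeasurableSet
      (⋂ n, {p : Cantor × Cantor | ∃ k, ∀ i < m n k, p.2 i = p.1 (k + i)}) :=
    MeasurableSet.iInter fun n => (Cantor.isOpen_setOf_exists_block (m n)).measurableSet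
  refine ⟨_, hmeas, fun x => ?_, fun y => ?_⟩
  · have hle : ∀ n : ℕ, φ {y | (x, y) ∈
        ⋂ n, {p : Cantor × Cantor | ∃ k, ∀ i < m n k, p.2 i = p.1 (k + i)}} ≤ (1 / 2) ^ n := by
      intro n
      have hcyl : ∀ k, MeasurableSet {y : Cantor | ∀ i < m n k, y i = x (k + i)} := fun k =>
        (Cantor.isClopen_cylinder (fun i => x (k + i)) (m n k)).isOpen.measurableSet
      refine (hφ.1.2.1 _ (⋃ k, {y : Cantor | ∀ i < m n k, y i = x (k + i)})
        (measurable_prodMk_left hmeas) (MeasurableSet.iUnion hcyl) fun y hy => ?_).trans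
        (hφ.iUnion_le_s15 hcyl fun k => (hm n k fun i => x (k + i)).le)
      exact mem_iUnion.2 (mem_iInter.1 hy n)
    have hlim : Tendsto (fun n : ℕ => (1 / 2 : ℝ≥0) ^ n) atTop (nhds 0) :=
      NNReal.tendsto_pow_atTop_nhds_zero_of_lt_one (NNReal.half_lt_self one_ne_zero)
    exact le_antisymm (ge_of_tendsto' hlim hle) zero_le
  · have hcompl : {x : Cantor | (x, y) ∉
        ⋂ n, {p : Cantor × Cantor | ∃ k, ∀ i < m n k, p.2 i = p.1 (k + i)}}ᶜ =
        ⋂ n, {x : Cantor | ∃ k, ∀ i < m n k, y i = x (k + i)} := by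
      ext x; simp
    rw [IsMeagre, hcompl]
    exact countable_iInter_mem.2 fun n => residual_of_dense_open
      ((Cantor.isOpen_setOf_exists_block (m n)).preimage (by fun_prop : Continuous fun x => (x, y)))
      (Cantor.dense_setOf_exists_block (m n) y)
end

section
/- Let I be a σ-ideal on the Borel subsets of Cantor space 2^ℕ in which compact sets are dense. Then the partial order of I-positive Borel sets under inclusion is not σ-centered: there is no sequence (X_k) of families of I-positive Borel sets such that every I-positive Borel set belongs to some X_k and each X_k is centered, i.e. every finite subfamily of X_k has I-positive intersection. -/
open Set

/-- `I` is a σ-ideal on the Borel subsets of Cantor space. -/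
def SigmaIdeal (I : Set (Set Cantor)) : Prop :=
  (∀ A ∈ I, MeasurableSet A) ∧
  (∀ x : Cantor, ({x} : Set Cantor) ∈ I) ∧
  (∀ A B : Set Cantor, MeasurableSet A → A ⊆ B → B ∈ I → A ∈ I) ∧
  (∀ A : ℕ → Set Cantor, (∀ n, A n ∈ I) → (⋃ n, A n) ∈ I) ∧
  (univ : Set Cantor) ∉ I

/-- Compact sets are dense in `I`. -/
def CompactDense (I : Set (Set Cantor)) : Prop :=
  ∀ A : Set Cantor, MeasurableSet A → A ∉ I → ∃ C : Set Cantor, IsCompact C ∧ C ⊆ A ∧ C ∉ I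

theorem SigmaIdeal.empty_mem {I : Set (Set Cantor)} (hI : SigmaIdeal I) : (∅ : Set Cantor) ∈ I :=
  hI.2.2.1 ∅ {fun _ => false} MeasurableSet.empty (empty_subset _) (hI.2.1 _)

/-- In a σ-ideal, the complement of a sequence of points is positive. -/
theorem SigmaIdeal.compl_range_notMem {I : Set (Set Cantor)} (hI : SigmaIdeal I)
    (f : ℕ → Cantor) : (range f)ᶜ ∉ I := by
  obtain ⟨-, hsingle, -, hunion, huniv⟩ := hI
  intro hcompl
  have hcover : (⋃ n, Nat.casesOn (motive := fun _ => Set Cantor) n (range f)ᶜ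
      fun m => {f m}) = univ := by
    refine eq_univ_of_forall fun x => ?_
    by_cases hx : x ∈ range f
    · obtain ⟨m, rfl⟩ := hx
      exact mem_iUnion.2 ⟨m + 1, rfl⟩
    · exact mem_iUnion.2 ⟨0, hx⟩
  refine huniv (hcover ▸ hunion _ fun n => ?_)
  cases n with
  | zero => exact hcompl
  | succ m => exact hsingle _

/-- The compact members of a family with the finite intersection property have a common point. -/
theorem exists_mem_of_isCompact_of_finite_inter {α : Type*} [TopologicalSpace α] [CompactSpace α]
    [T2Space α] [Nonempty α] {X : Set (Set α)}
    (hX : ∀ F ⊆ X, F.Finite → F.Nonempty → (⋂₀ F).Nonempty) :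
    ∃ x, ∀ C ∈ X, IsCompact C → x ∈ C := by
  obtain ⟨x, -, hx⟩ := isCompact_univ.inter_iInter_nonempty
    (fun C : {C : Set α // C ∈ X ∧ IsCompact C} => (C : Set α))
    (fun C => C.2.2.isClosed) fun u => by
      rcases u.eq_empty_or_nonempty with rfl | hu
      · simp
      · have h := hX (Subtype.val '' (u : Set {C : Set α // C ∈ X ∧ IsCompact C}))
          (by rintro _ ⟨C, -, rfl⟩; exact C.2.1) (u.finite_toSet.image _) (hu.to_set.image _)
        rw [univ_inter]
        simpa only [sInter_image, Finset.mem_coe] using h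
  exact ⟨x, fun C hC hcomp => mem_iInter.1 hx ⟨C, hC, hcomp⟩⟩

/-- If compact sets are dense in the σ-ideal `I`, then the poset of
`I`-positive Borel sets is not σ-centered. -/
theorem stmt16 (I : Set (Set Cantor)) (hI : SigmaIdeal I) (hcd : CompactDense I) :
    ¬ ∃ X : ℕ → Set (Set Cantor),
        (∀ k, ∀ A ∈ X k, MeasurableSet A ∧ A ∉ I) ∧
        (∀ A : Set Cantor, MeasurableSet A → A ∉ I → ∃ k, A ∈ X k) ∧
        (∀ k, ∀ F : Set (Set Cantor), F ⊆ X k → F.Finite → F.Nonempty → ⋂₀ F ∉ I) := by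
  rintro ⟨X, -, hcover, hcentered⟩
  have hpoint : ∀ k, ∃ x, ∀ C ∈ X k, IsCompact C → x ∈ C := fun k =>
    exists_mem_of_isCompact_of_finite_inter fun F hF hfin hne =>
      nonempty_iff_ne_empty.2 fun h => hcentered k F hF hfin hne (h ▸ hI.empty_mem)
  choose f hf using hpoint
  obtain ⟨C, hC, hsub, hpos⟩ := hcd _ (countable_range f).measurableSet.compl
    (hI.compl_range_notMem f)
  obtain ⟨k, hk⟩ := hcover C hC.measurableSet hpos
  exact hsub (hf k C hk hC) (mem_range_self k)
end

section
/- Let φ be a diffuse Maharam submeasure on the Borel subsets of Cantor space 2^ℕ and let n ≥ 1 be a natural number. Then the collection of φ-positive Borel sets is σ-n-linked: there is a sequence (F_k) of families of φ-positive Borel sets such that every φ-positive Borel set belongs to some F_k, and for each k, any n sets B_1, …, B_n ∈ F_k satisfy φ(B_1 ∩ … ∩ B_n) > 0. -/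
open Set Filter NNReal

open MeasureTheory

theorem Submeasure.biUnion_le_s17 {φ : Set Cantor → ℝ≥0} (hφ : Submeasure φ) {ι : Type*}
    (s : Finset ι) (B : ι → Set Cantor) (hB : ∀ i, MeasurableSet (B i)) :
    φ (⋃ i ∈ s, B i) ≤ ∑ i ∈ s, φ (B i) := by
  classical
  induction s using Finset.induction_on with
  | empty => simp [hφ.1]
  | insert a s ha ih =>
    rw [Finset.set_biUnion_insert, Finset.sum_insert ha]
    exact (hφ.2.2 _ _ (hB a) (s.measurableSet_biUnion fun i _ => hB i)).trans (by gcongr)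

/-- Borel sets are approximated in a Maharam submeasure by members of any algebra of sets
generating the Borel σ-algebra. -/
theorem Maharam.exists_symmDiff_lt {φ : Set Cantor → ℝ≥0} (hφ : Maharam φ)
    {𝒜 : Set (Set Cantor)} (h𝒜 : IsSetAlgebra 𝒜)
    (hgen : (MeasurableSpace.pi : MeasurableSpace Cantor) = MeasurableSpace.generateFrom 𝒜)
    {A : Set Cantor} (hA : MeasurableSet A) {ε : ℝ≥0} (hε : 0 < ε) :
    ∃ C ∈ 𝒜, φ (symmDiff A C) < ε := by
  have hm : ∀ C ∈ 𝒜, MeasurableSet C := fun C hC => by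
    rw [hgen]
    exact MeasurableSpace.measurableSet_generateFrom hC
  obtain ⟨hsub, hcont⟩ := hφ
  induction A, hA using MeasurableSpace.induction_on_inter hgen
    (fun s hs t ht _ => h𝒜.inter_mem hs ht) generalizing ε with
  | empty => exact ⟨∅, h𝒜.empty_mem, by simpa [hsub.1] using hε⟩
  | basic t ht => exact ⟨t, ht, by simpa [hsub.1] using hε⟩
  | compl t _ ih =>
    obtain ⟨C, hC, h⟩ := ih hε
    exact ⟨Cᶜ, h𝒜.compl_mem hC, by rwa [compl_symmDiff_compl]⟩
  | iUnion f _ hf ih =>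
    let tail : ℕ → Set Cantor := fun N => (⋃ i, f i) \ ⋃ i ∈ Finset.range N, f i
    have htail_meas : ∀ N, MeasurableSet (tail N) := fun N =>
      (MeasurableSet.iUnion hf).diff (Finset.measurableSet_biUnion _ fun i _ => hf i)
    have htail_anti : Antitone tail := fun M N hMN =>
      sdiff_subset_sdiff_right
        (biUnion_subset_biUnion_left fun i hi => Finset.range_mono hMN hi)
    have htail_inter : ⋂ N, tail N = ∅ := by
      refine eq_empty_of_forall_notMem fun x hx => ?_
      rw [mem_iInter] at hx
      obtain ⟨i, hi⟩ := mem_iUnion.1 (hx 0).1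
      exact (hx (i + 1)).2 (mem_biUnion (Finset.mem_coe.2 (Finset.self_mem_range_succ i)) hi)
    have hlim := hcont tail htail_meas htail_anti
    rw [htail_inter, hsub.1] at hlim
    obtain ⟨N, hN⟩ := (hlim.eventually_lt_const (half_pos hε)).exists
    have hδ : 0 < ε / 2 / (N + 1) := by positivity
    choose C hC hlt using fun i => ih i hδ
    have hmeas : ∀ i, MeasurableSet (symmDiff (f i) (C i)) := fun i =>
      (hf i).symmDiff (hm _ (hC i))
    have hCN : (⋃ i ∈ Finset.range N, C i) ∈ 𝒜 := h𝒜.biUnion_mem _ fun i _ => hC i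
    refine ⟨_, hCN, ?_⟩
    have hincl : symmDiff (⋃ i, f i) (⋃ i ∈ Finset.range N, C i) ⊆
        tail N ∪ ⋃ i ∈ Finset.range N, symmDiff (f i) (C i) := by
      intro x hx
      simp only [tail, mem_symmDiff, mem_union, Set.mem_sdiff, mem_iUnion, Finset.mem_range,
        exists_prop] at hx ⊢
      grind
    have hU : MeasurableSet (⋃ i ∈ Finset.range N, symmDiff (f i) (C i)) :=
      Finset.measurableSet_biUnion _ fun i _ => hmeas i
    calc φ (symmDiff (⋃ i, f i) (⋃ i ∈ Finset.range N, C i))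
        ≤ φ (tail N ∪ ⋃ i ∈ Finset.range N, symmDiff (f i) (C i)) :=
          hsub.2.1 _ _ ((MeasurableSet.iUnion hf).symmDiff (hm _ hCN))
            ((htail_meas N).union hU) hincl
      _ ≤ φ (tail N) + φ (⋃ i ∈ Finset.range N, symmDiff (f i) (C i)) :=
          hsub.2.2 _ _ (htail_meas N) hU
      _ ≤ φ (tail N) + ∑ i ∈ Finset.range N, φ (symmDiff (f i) (C i)) := by
          gcongr
          exact hsub.biUnion_le_s17 _ _ hmeas
      _ ≤ φ (tail N) + ∑ _i ∈ Finset.range N, ε / 2 / (N + 1) := by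
          gcongr with i
          exact (hlt i).le
      _ ≤ φ (tail N) + ε / 2 := by
          gcongr
          rw [Finset.sum_const, Finset.card_range, nsmul_eq_mul, mul_div_assoc', mul_comm]
          refine div_le_of_le_mul₀ (by positivity) (by positivity) ?_
          gcongr
          exact le_self_add
      _ < ε / 2 + ε / 2 := by gcongr
      _ = ε := add_halves ε

/-- Sets missing less than `1 / n` of `C` have `n`-fold intersections that are positive. -/
theorem Submeasure.iInter_pos {φ : Set Cantor → ℝ≥0} (hφ : Submeasure φ) {n : ℕ} (hn : 1 ≤ n)
    {C : Set Cantor} (hC : MeasurableSet C) {B : Fin n → Set Cantor}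
    (hB : ∀ i, MeasurableSet (B i)) (h : ∀ i, n * φ (C \ B i) < φ C) :
    0 < φ (⋂ i, B i) := by
  have hn0 : (0 : ℝ≥0) < n := by exact_mod_cast hn
  have hD : ∀ i, MeasurableSet (C \ B i) := fun i => hC.diff (hB i)
  have hU : MeasurableSet (⋃ i ∈ Finset.univ, C \ B i) :=
    Finset.measurableSet_biUnion _ fun i _ => hD i
  have hI : MeasurableSet (⋂ i, B i) := MeasurableSet.iInter hB
  have hincl : C ⊆ (⋂ i, B i) ∪ ⋃ i ∈ Finset.univ, C \ B i := by
    intro x hx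
    by_cases hxB : ∀ i, x ∈ B i
    · exact Or.inl (mem_iInter.2 hxB)
    · push Not at hxB
      obtain ⟨i, hi⟩ := hxB
      exact Or.inr (mem_biUnion (Finset.mem_coe.2 (Finset.mem_univ i)) ⟨hx, hi⟩)
  have hle : φ C ≤ φ (⋂ i, B i) + ∑ i, φ (C \ B i) :=
    (hφ.2.1 _ _ hC (hI.union hU) hincl).trans <|
      (hφ.2.2 _ _ hI hU).trans (by gcongr; exact hφ.biUnion_le_s17 _ _ hD)
  have hsum : ∑ i, φ (C \ B i) < φ C := by
    calc ∑ i, φ (C \ B i) < ∑ _i : Fin n, φ C / n :=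
          Finset.sum_lt_sum_of_nonempty ⟨⟨0, hn⟩, Finset.mem_univ _⟩ fun i _ => by
            rw [lt_div_iff₀ hn0, mul_comm]
            exact h i
      _ = φ C := by
          rw [Finset.sum_const, Finset.card_univ, Fintype.card_fin, nsmul_eq_mul,
            mul_div_cancel₀ _ hn0.ne']
  exact pos_of_lt_add_left (hsum.trans_le hle)

/-- For a diffuse Maharam submeasure `φ`, the collection of `φ`-positive Borel
sets is σ-`n`-linked for every `n ≥ 1`. -/
theorem stmt17 (φ : Set Cantor → ℝ≥0) (hφ : Maharam φ) (hd : Diffuse φ)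
    (n : ℕ) (hn : 1 ≤ n) :
    ∃ F : ℕ → Set (Set Cantor),
      (∀ k, ∀ A ∈ F k, MeasurableSet A ∧ φ A ≠ 0) ∧
      (∀ A : Set Cantor, MeasurableSet A → φ A ≠ 0 → ∃ k, A ∈ F k) ∧
      (∀ k, ∀ B : Fin n → Set Cantor, (∀ i, B i ∈ F k) → 0 < φ (⋂ i, B i)) := by
  have hsub := hφ.1
  let 𝒜 := generateSetAlgebra (MeasurableSpace.countableGeneratingSet Cantor)
  have h𝒜 : IsSetAlgebra 𝒜 := isSetAlgebra_generateSetAlgebra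
  have hgen : (MeasurableSpace.pi : MeasurableSpace Cantor) = MeasurableSpace.generateFrom 𝒜 := by
    rw [generateFrom_generateSetAlgebra_eq, MeasurableSpace.generateFrom_countableGeneratingSet]
  have hm : ∀ C ∈ 𝒜, MeasurableSet C := fun C hC => by
    rw [hgen]
    exact MeasurableSpace.measurableSet_generateFrom hC
  have hcount : 𝒜.Countable :=
    countable_generateSetAlgebra MeasurableSpace.countable_countableGeneratingSet
  obtain ⟨C, hC⟩ := hcount.exists_eq_range ⟨∅, h𝒜.empty_mem⟩
  have hCm : ∀ k, MeasurableSet (C k) := fun k => hm _ (hC.symm ▸ mem_range_self k)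
  refine ⟨fun k => {A | (MeasurableSet A ∧ φ A ≠ 0) ∧ n * φ (C k \ A) < φ (C k)},
    fun k A hA => hA.1, fun A hA hpos => ?_, fun k B hB =>
      hsub.iInter_pos hn (hCm k) (fun i => (hB i).1.1) fun i => (hB i).2⟩
  have hδ : 0 < φ A / (n + 1) := by positivity
  obtain ⟨D, hD, hlt⟩ := hφ.exists_symmDiff_lt h𝒜 hgen hA hδ
  have hDm := hm D hD
  rw [hC] at hD
  obtain ⟨k, rfl⟩ := hD
  refine ⟨k, ⟨hA, hpos⟩, ?_⟩
  set S := symmDiff A (C k)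
  have hSm : MeasurableSet S := hA.symmDiff hDm
  have hdiff : φ (C k \ A) ≤ φ S := hsub.2.1 _ _ (hDm.diff hA) hSm fun x hx => Or.inr hx
  have hAle : φ A ≤ φ (C k) + φ S :=
    (hsub.2.1 _ _ hA (hDm.union hSm) fun x hx => by
      by_cases hxC : x ∈ C k
      · exact Or.inl hxC
      · exact Or.inr (Or.inl ⟨hx, hxC⟩)).trans (hsub.2.2 _ _ hDm hSm)
  rw [lt_div_iff₀ (by positivity), mul_add, mul_one] at hlt
  refine lt_of_add_lt_add_right (a := φ S) ?_
  calc n * φ (C k \ A) + φ S ≤ n * φ S + φ S := by gcongr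
    _ = φ S * n + φ S := by rw [mul_comm]
    _ < φ A := hlt
    _ ≤ φ (C k) + φ S := hAle
end

section
/- Let φ be a Maharam submeasure on the Borel subsets of Cantor space 2^ℕ and define ρ(A,B) = φ(A Δ B) for Borel sets A, B, where Δ denotes symmetric difference. Then the pseudometric ρ on the collection of Borel sets is complete: for every sequence (A_n) of Borel sets which is ρ-Cauchy (for every ε > 0 there is N such that φ(A_n Δ A_m) < ε for all n, m ≥ N) there is a Borel set A with lim_n φ(A_n Δ A) = 0. -/
open Set Filter NNReal

/-- A finite union has submeasure at most the sum of the submeasures. -/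
theorem Submeasure.biUnion_range_le {φ : Set Cantor → ℝ≥0} (hφ : Submeasure φ)
    {S : ℕ → Set Cantor} (hS : ∀ n, MeasurableSet (S n)) (n : ℕ) :
    φ (⋃ i ∈ Finset.range n, S i) ≤ ∑ i ∈ Finset.range n, φ (S i) := by
  induction n with
  | zero => simp [hφ.1]
  | succ n ih =>
    rw [Finset.range_add_one, Finset.set_biUnion_insert, Finset.sum_insert (by simp)]
    exact (hφ.2.2 _ _ (hS n) (Finset.measurableSet_biUnion _ fun i _ => hS i)).trans
      (add_le_add_right ih _)

/-- A Maharam submeasure of an increasing union is bounded by any bound for its terms. -/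
theorem Maharam.iUnion_le_of_monotone {φ : Set Cantor → ℝ≥0} (hφ : Maharam φ)
    {E : ℕ → Set Cantor} (hE : ∀ n, MeasurableSet (E n)) (hmono : Monotone E)
    {c : ℝ≥0} (hc : ∀ n, φ (E n) ≤ c) : φ (⋃ n, E n) ≤ c := by
  have hU : MeasurableSet (⋃ n, E n) := MeasurableSet.iUnion hE
  have hlim := hφ.2 (fun n => (⋃ k, E k) \ E n) (fun n => hU.diff (hE n))
    (fun _ _ h => sdiff_subset_sdiff_right (hmono h))
  rw [← sdiff_iUnion, Set.sdiff_self, hφ.1.1] at hlim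
  have hlim' : Tendsto (fun n => c + φ ((⋃ k, E k) \ E n)) atTop (nhds c) := by
    simpa using hlim.const_add c
  refine ge_of_tendsto' hlim' fun n => ?_
  calc φ (⋃ k, E k) = φ (E n ∪ ((⋃ k, E k) \ E n)) := by
        rw [union_sdiff_cancel (subset_iUnion E n)]
    _ ≤ φ (E n) + φ ((⋃ k, E k) \ E n) := hφ.1.2.2 _ _ (hE n) (hU.diff (hE n))
    _ ≤ c + φ ((⋃ k, E k) \ E n) := by gcongr; exact hc n

/-- Countable subadditivity of Maharam submeasures. -/
theorem Maharam.iUnion_le_of_sum_le {φ : Set Cantor → ℝ≥0} (hφ : Maharam φ)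
    {S : ℕ → Set Cantor} (hS : ∀ n, MeasurableSet (S n)) {c : ℝ≥0}
    (hc : ∀ n, ∑ i ∈ Finset.range n, φ (S i) ≤ c) : φ (⋃ n, S n) ≤ c := by
  have heq : ⋃ n, S n = ⋃ n, ⋃ i ∈ Finset.range n, S i := by
    ext x
    simp only [mem_iUnion, Finset.mem_range, exists_prop]
    exact ⟨fun ⟨i, hi⟩ => ⟨i + 1, i, i.lt_succ_self, hi⟩, fun ⟨_, i, _, hi⟩ => ⟨i, hi⟩⟩
  rw [heq]
  refine hφ.iUnion_le_of_monotone
    (fun n => Finset.measurableSet_biUnion _ fun i _ => hS i) (fun m n h => ?_)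
    (fun n => (hφ.1.biUnion_range_le hS n).trans (hc n))
  exact biUnion_subset_biUnion_left fun i hi => Finset.range_mono h hi

/-- A point of the symmetric difference of `C m` with the lower limit of `C` lies in some
later consecutive symmetric difference. -/
theorem symmDiff_liminf_subset {α : Type*} (C : ℕ → Set α) (m : ℕ) :
    symmDiff (C m) (⋃ n, ⋂ k, C (n + k)) ⊆
      ⋃ i, symmDiff (C (m + i)) (C (m + i + 1)) := by
  intro x hx
  by_contra hnot
  simp only [mem_iUnion, mem_symmDiff, not_exists] at hnot
  have hconst : ∀ i, x ∈ C (m + i) ↔ x ∈ C m := by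
    intro i
    induction i with
    | zero => rfl
    | succ i ih =>
      have := hnot i
      rw [← add_assoc]
      tauto
  have hlim : x ∈ ⋃ n, ⋂ k, C (n + k) ↔ x ∈ C m := by
    simp only [mem_iUnion, mem_iInter]
    refine ⟨fun ⟨n, hn⟩ => (hconst n).1 ?_, fun h => ⟨m, fun k => (hconst k).2 h⟩⟩
    rw [add_comm]
    exact hn m
  rw [mem_symmDiff] at hx
  tauto

/-- The pseudometric `ρ(A,B) = φ(A Δ B)` induced by a Maharam submeasure `φ` on
the Borel sets is complete: every `ρ`-Cauchy sequence of Borel sets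
`ρ`-converges to a Borel set. -/
theorem stmt18 (φ : Set Cantor → ℝ≥0) (hφ : Maharam φ)
    (A : ℕ → Set Cantor) (hA : ∀ n, MeasurableSet (A n))
    (hCauchy : ∀ ε : ℝ≥0, 0 < ε → ∃ N : ℕ, ∀ n ≥ N, ∀ m ≥ N,
      φ (symmDiff (A n) (A m)) < ε) :
    ∃ B : Set Cantor, MeasurableSet B ∧
      Filter.Tendsto (fun n => φ (symmDiff (A n) B)) Filter.atTop (nhds 0) := by
  choose N hN using fun k : ℕ => hCauchy ((1 / 2) ^ k) (by positivity)
  let g : ℕ → ℕ := fun k => ∑ i ∈ Finset.range (k + 1), N i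
  have hNg : ∀ k, N k ≤ g k := fun k =>
    Finset.single_le_sum (f := N) (fun _ _ => Nat.zero_le _) (by simp)
  have hg : ∀ k, g k ≤ g (k + 1) := fun k => by
    simp only [g, Finset.sum_range_succ _ (k + 1)]
    exact Nat.le_add_right _ _
  have hB : MeasurableSet (⋃ n, ⋂ k, A (g (n + k))) :=
    MeasurableSet.iUnion fun n => MeasurableSet.iInter fun k => hA _
  have hsum : ∀ n : ℕ, ∑ i ∈ Finset.range n, (1 / 2 : ℝ≥0) ^ i ≤ 2 := fun n => by
    rw [← NNReal.coe_le_coe]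
    push_cast
    exact sum_geometric_two_le n
  have hsub : ∀ m, φ (symmDiff (A (g m)) (⋃ n, ⋂ k, A (g (n + k)))) ≤ (1 / 2) ^ m * 2 := by
    intro m
    have hS : ∀ i, MeasurableSet (symmDiff (A (g (m + i))) (A (g (m + i + 1)))) :=
      fun i => (hA _).symmDiff (hA _)
    refine (hφ.1.2.1 _ _ ((hA _).symmDiff hB) (MeasurableSet.iUnion hS)
      (symmDiff_liminf_subset (fun k => A (g k)) m)).trans
      (hφ.iUnion_le_of_sum_le hS fun n => ?_)
    calc _ ≤ ∑ i ∈ Finset.range n, (1 / 2 : ℝ≥0) ^ (m + i) :=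
          Finset.sum_le_sum fun i _ =>
            (hN (m + i) _ (hNg _) _ ((hNg _).trans (hg _))).le
      _ = (1 / 2) ^ m * ∑ i ∈ Finset.range n, (1 / 2 : ℝ≥0) ^ i := by
          simp only [pow_add, Finset.mul_sum]
      _ ≤ _ := by gcongr; exact hsum n
  refine ⟨_, hB, ?_⟩
  have hpow : Tendsto (fun m : ℕ => (1 / 2 : ℝ≥0) ^ m * 3) atTop (nhds 0) := by
    simpa using (tendsto_pow_atTop_nhds_zero_of_lt_one (r := (1 / 2 : ℝ≥0))
      zero_le (by rw [← NNReal.coe_lt_coe]; norm_num)).mul_const 3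
  rw [tendsto_order]
  refine ⟨fun a ha => absurd ha not_lt_zero, fun ε hε => ?_⟩
  obtain ⟨m, hm⟩ := (hpow.eventually_lt_const hε).exists
  filter_upwards [eventually_ge_atTop (N m)] with n hn
  refine lt_of_le_of_lt ?_ hm
  calc _ ≤ φ (symmDiff (A n) (A (g m)) ∪ symmDiff (A (g m)) (⋃ n, ⋂ k, A (g (n + k)))) :=
        hφ.1.2.1 _ _ ((hA _).symmDiff hB)
          (((hA _).symmDiff (hA _)).union ((hA _).symmDiff hB)) (symmDiff_triangle _ _ _)
    _ ≤ φ (symmDiff (A n) (A (g m))) + φ (symmDiff (A (g m)) (⋃ n, ⋂ k, A (g (n + k)))) :=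
        hφ.1.2.2 _ _ ((hA _).symmDiff (hA _)) ((hA _).symmDiff hB)
    _ ≤ (1 / 2) ^ m + (1 / 2) ^ m * 2 := add_le_add (hN m n hn _ (hNg m)).le (hsub m)
    _ = (1 / 2) ^ m * 3 := by ring
end

section
/- Let φ be a Maharam submeasure on the Borel subsets of Cantor space 2^ℕ and define ρ(A,B) = φ(A Δ B) for Borel sets A, B, where Δ denotes symmetric difference. Then the pseudometric space of Borel sets with ρ is separable: there is a countable collection D of Borel sets such that for every Borel set A and every ε > 0 there is D ∈ D with φ(A Δ D) < ε. -/
open Set Filter NNReal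

theorem measurableSet_accumulate_nat {α : Type*} [MeasurableSpace α] {s : ℕ → Set α}
    (hs : ∀ n, MeasurableSet (s n)) (n : ℕ) : MeasurableSet (Set.accumulate s n) :=
  MeasurableSet.biUnion (Set.to_countable _) fun i _ => hs i

theorem Submeasure.lt_of_subset_union {φ : Set Cantor → ℝ≥0} (hφ : Submeasure φ)
    {A B C : Set Cantor} (hA : MeasurableSet A) (hB : MeasurableSet B) (hC : MeasurableSet C)
    (h : A ⊆ B ∪ C) {ε : ℝ≥0} (hBε : φ B < ε / 2) (hCε : φ C < ε / 2) : φ A < ε :=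
  calc φ A ≤ φ (B ∪ C) := hφ.2.1 A (B ∪ C) hA (hB.union hC) h
    _ ≤ φ B + φ C := hφ.2.2 B C hB hC
    _ < ε / 2 + ε / 2 := add_lt_add hBε hCε
    _ = ε := add_halves ε

/-- `A` lies in the closure of the family `D` for the pseudometric induced by `φ`. -/
def Approximable (φ : Set Cantor → ℝ≥0) (D : Set (Set Cantor)) (A : Set Cantor) : Prop :=
  ∀ ε : ℝ≥0, 0 < ε → ∃ B ∈ D, φ (symmDiff A B) < ε

section Approximable

variable {φ : Set Cantor → ℝ≥0} {D : Set (Set Cantor)} {A A' : Set Cantor}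

theorem approximable_of_mem (hφ : φ ∅ = 0) (hA : A ∈ D) : Approximable φ D A :=
  fun ε hε => ⟨A, hA, by simpa [hφ] using hε⟩

theorem Approximable.compl (hD : MeasureTheory.IsSetAlgebra D) (h : Approximable φ D A) :
    Approximable φ D Aᶜ := by
  intro ε hε
  obtain ⟨B, hB, hlt⟩ := h ε hε
  exact ⟨Bᶜ, hD.compl_mem hB, by rwa [compl_symmDiff_compl]⟩

theorem Approximable.union (hφ : Submeasure φ) (hD : MeasureTheory.IsSetAlgebra D)
    (hDm : ∀ B ∈ D, MeasurableSet B) (hA : MeasurableSet A) (hA' : MeasurableSet A')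
    (h : Approximable φ D A) (h' : Approximable φ D A') : Approximable φ D (A ∪ A') := by
  intro ε hε
  obtain ⟨B, hB, hlt⟩ := h (ε / 2) (half_pos hε)
  obtain ⟨B', hB', hlt'⟩ := h' (ε / 2) (half_pos hε)
  have hm := hDm B hB
  have hm' := hDm B' hB'
  refine ⟨B ∪ B', hD.union_mem hB hB', hφ.lt_of_subset_union ((hA.union hA').symmDiff
    (hm.union hm')) (hA.symmDiff hm) (hA'.symmDiff hm') ?_ hlt hlt'⟩
  intro x
  simp only [Set.mem_symmDiff, Set.mem_union]
  tauto

theorem Approximable.accumulate (hφ : Submeasure φ) (hD : MeasureTheory.IsSetAlgebra D)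
    (hDm : ∀ B ∈ D, MeasurableSet B) {s : ℕ → Set Cantor} (hs : ∀ n, MeasurableSet (s n))
    (h : ∀ n, Approximable φ D (s n)) (n : ℕ) : Approximable φ D (Set.accumulate s n) := by
  induction n with
  | zero => simpa using h 0
  | succ n ih =>
    rw [Set.accumulate_succ]
    exact ih.union hφ hD hDm (measurableSet_accumulate_nat hs n) (hs _) (h _)

theorem Maharam.tendsto_iUnion_diff_accumulate (hφ : Maharam φ) {s : ℕ → Set Cantor}
    (hs : ∀ n, MeasurableSet (s n)) :
    Tendsto (fun n => φ ((⋃ i, s i) \ Set.accumulate s n)) atTop (nhds 0) := by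
  have h := hφ.2 (fun n => (⋃ i, s i) \ Set.accumulate s n)
    (fun n => (MeasurableSet.iUnion hs).diff (measurableSet_accumulate_nat hs n))
    (fun m n hmn => Set.sdiff_subset_sdiff_right (Set.monotone_accumulate hmn))
  rwa [← Set.sdiff_iUnion, Set.iUnion_accumulate, Set.sdiff_self, hφ.1.1] at h

theorem Approximable.iUnion (hφ : Maharam φ) (hD : MeasureTheory.IsSetAlgebra D)
    (hDm : ∀ B ∈ D, MeasurableSet B) {s : ℕ → Set Cantor} (hs : ∀ n, MeasurableSet (s n))
    (h : ∀ n, Approximable φ D (s n)) : Approximable φ D (⋃ n, s n) := by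
  intro ε hε
  obtain ⟨n, hn⟩ :=
    ((hφ.tendsto_iUnion_diff_accumulate hs).eventually_lt_const (half_pos hε)).exists
  obtain ⟨B, hB, hlt⟩ := Approximable.accumulate hφ.1 hD hDm hs h n (ε / 2) (half_pos hε)
  have hU := MeasurableSet.iUnion hs
  have hacc := measurableSet_accumulate_nat hs n
  have hm := hDm B hB
  refine ⟨B, hB, hφ.1.lt_of_subset_union (hU.symmDiff hm) (hU.diff hacc) (hacc.symmDiff hm)
    ?_ hn hlt⟩
  have hsub : Set.accumulate s n ⊆ ⋃ i, s i := Set.accumulate_subset_iUnion n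
  intro x
  have hx := @hsub x
  simp only [Set.mem_symmDiff, Set.mem_union, Set.mem_sdiff]
  tauto

end Approximable

/-- The pseudometric space of Borel sets with `ρ(A,B) = φ(A Δ B)` induced by a
Maharam submeasure `φ` is separable. -/
theorem stmt19 (φ : Set Cantor → ℝ≥0) (hφ : Maharam φ) :
    ∃ D : Set (Set Cantor), D.Countable ∧ (∀ B ∈ D, MeasurableSet B) ∧
      ∀ A : Set Cantor, MeasurableSet A → ∀ ε : ℝ≥0, 0 < ε →
        ∃ B ∈ D, φ (symmDiff A B) < ε := by
  set C := MeasurableSpace.countableGeneratingSet Cantor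
  set D := MeasureTheory.generateSetAlgebra C
  have hgen : MeasurableSpace.generateFrom D = MeasurableSpace.pi := by
    rw [MeasureTheory.generateFrom_generateSetAlgebra_eq,
      MeasurableSpace.generateFrom_countableGeneratingSet]
  have hD : MeasureTheory.IsSetAlgebra D := MeasureTheory.isSetAlgebra_generateSetAlgebra
  have hDm : ∀ B ∈ D, MeasurableSet B := fun B hB => by
    rw [← hgen]
    exact MeasurableSpace.measurableSet_generateFrom hB
  refine ⟨D, MeasureTheory.countable_generateSetAlgebra
    MeasurableSpace.countable_countableGeneratingSet, hDm, fun A hA => ?_⟩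
  change Approximable φ D A
  rw [← hgen] at hA
  induction A, hA using MeasurableSpace.generateFrom_induction with
  | hC A hA _ => exact approximable_of_mem hφ.1.1 hA
  | empty => exact approximable_of_mem hφ.1.1 hD.empty_mem
  | compl A _ ih => exact ih.compl hD
  | iUnion s hs ih => exact Approximable.iUnion hφ hD hDm (fun n => hgen ▸ hs n) ih
end
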